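/- arXiv:1305.0177 — 3 statements merged into one kernel-verified Lean document; each statement's English description precedes it below -/
import Mathlib

section
/- There is a constant k_0 ∈ ℕ such that for every k ≥ k_0 and every d with 2k·ln k − ln k − 4 ≤ d ≤ 2k·ln k, the following holds for all sufficiently large n and every near-balanced σ: V → {1,...,k}: in the random multigraph G'(σ), P[max_{1≤i<j≤k} e(W_i,V_j) ≥ 2n·ln ln k/k] ≤ exp(−11n/k). -/
/-- Uniform counting probability on a finite sample space `Ω`. -/
noncomputable def prob {Ω : Type*} (p : Ω → Prop) : ℝ :=
  (Nat.card {x : Ω // p x} : ℝ) / (Nat.card Ω : ℝ)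

/-- The sample space of the random multigraph `G'(σ)`: `m` ordered pairs drawn
uniformly and independently from `{(u,v) : σ u ≠ σ v}`. -/
abbrev CondSpace (n m k : ℕ) (σ : Fin n → Fin k) : Type :=
  {e : Fin m → Fin n × Fin n // ∀ i : Fin m, σ (e i).1 ≠ σ (e i).2}

/-- `e(A,B)`: the number of edges (with multiplicity) with one endpoint in `A`
and the other in `B`. -/
noncomputable def eSet {n m : ℕ} (e : Fin m → Fin n × Fin n) (A B : Set (Fin n)) : ℕ :=
  Nat.card {t : Fin m // ((e t).1 ∈ A ∧ (e t).2 ∈ B) ∨ ((e t).1 ∈ B ∧ (e t).2 ∈ A)}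

/-- `σ` is near-balanced: every color class has size `n/k` up to `n/(k·(ln k)^{1/3})`. -/
def NearBalanced (n k : ℕ) (σ : Fin n → Fin k) : Prop :=
  ∀ i : Fin k,
    |(Nat.card {v : Fin n // σ v = i} : ℝ) - n / k| ≤ n / (k * Real.log k ^ ((1 : ℝ) / 3))

/-- `ℓ = e^{−7}·ln k`. -/
noncomputable def ell (k : ℕ) : ℝ := Real.exp (-7) * Real.log k

/-- `W_i = {v ∈ V_i : ∃ j ≠ i, e(v,V_j) < 3ℓ}`. -/
def Wset {n m k : ℕ} (σ : Fin n → Fin k) (e : Fin m → Fin n × Fin n) (i : Fin k) :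
    Set (Fin n) :=
  {v | σ v = i ∧ ∃ j : Fin k, j ≠ i ∧ (eSet e {v} {u | σ u = j} : ℝ) < 3 * ell k}

open Finset

section Prob

variable {Ω : Type*}

lemma prob_mono [Finite Ω] {p q : Ω → Prop} (h : ∀ x, p x → q x) : prob p ≤ prob q := by
  unfold prob
  gcongr
  exact Nat.card_le_card_of_injective (Subtype.map id h)
    (Subtype.map_injective _ Function.injective_id)

lemma prob_or_le (p q : Ω → Prop) : prob (fun x => p x ∨ q x) ≤ prob p + prob q := by
  unfold prob
  rw [← add_div]
  gcongr
  exact_mod_cast Set.ncard_union_le {x | p x} {x | q x}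

lemma prob_exists_mem_le {ι : Type*} (s : Finset ι) (p : ι → Ω → Prop) :
    prob (fun x => ∃ i ∈ s, p i x) ≤ ∑ i ∈ s, prob (p i) := by
  classical
  induction s using Finset.induction_on with
  | empty => simp [prob]
  | insert a s ha ih =>
    rw [sum_insert ha]
    simp only [mem_insert, exists_eq_or_imp]
    exact (prob_or_le _ _).trans (by gcongr)

lemma prob_exists_mem_le_card_mul {ι : Type*} (s : Finset ι) (p : ι → Ω → Prop) (B : ℝ)
    (h : ∀ i ∈ s, prob (p i) ≤ B) : prob (fun x => ∃ i ∈ s, p i x) ≤ #s * B :=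
  (prob_exists_mem_le s p).trans (by simpa using sum_le_card_nsmul s _ B h)

end Prob

lemma prob_comp_equiv {Ω Ω' : Type*} (f : Ω ≃ Ω') (p : Ω' → Prop) :
    prob (fun x => p (f x)) = prob p := by
  unfold prob
  rw [Nat.card_congr f, Nat.card_congr (f.subtypeEquiv (p := fun x => p (f x)) (q := p) (by simp))]

/-- Chernoff's bound for the number of `m` independent uniform samples that land in `D`; both
tails are covered, according to the sign of `c`. -/
lemma prob_chernoff {P : Type*} [Fintype P] [DecidableEq P] [Nonempty P] (m : ℕ)
    (D : Finset P) (c T : ℝ) :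
    prob (fun f : Fin m → P => c * T ≤ c * (#{t | f t ∈ D} : ℝ)) ≤
      Real.exp (-(c * T) + (Real.exp c - 1) * (m * #D / Fintype.card P)) := by
  classical
  have hP : (0 : ℝ) < Fintype.card P := by exact_mod_cast Fintype.card_pos
  set w : P → ℝ := fun p => if p ∈ D then Real.exp c else 1 with hw
  have hsumw : ∑ p, w p = Fintype.card P * (1 + (Real.exp c - 1) * (#D / Fintype.card P)) := by
    have : ∀ p, w p = 1 + if p ∈ D then Real.exp c - 1 else 0 := by
      intro p; simp only [hw]; split_ifs <;> ring
    simp only [this, sum_add_distrib, sum_ite_mem, univ_inter, sum_const, nsmul_eq_mul, card_univ]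
    field_simp
  have hexp : ∀ f : Fin m → P, Real.exp (c * (#{t | f t ∈ D} : ℝ)) = ∏ t, w (f t) := by
    intro f
    simp only [hw, prod_ite, prod_const, one_pow, mul_one]
    rw [← Real.exp_nat_mul, mul_comm]
  have hmgf : ∑ f : Fin m → P, Real.exp (c * (#{t | f t ∈ D} : ℝ)) = (∑ p, w p) ^ m := by
    simp only [hexp]
    rw [Fintype.sum_pow]
  have hcard : (Nat.card {f : Fin m → P // c * T ≤ c * (#{t | f t ∈ D} : ℝ)} : ℝ) ≤
      Real.exp (-(c * T)) * (∑ p, w p) ^ m := by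
    rw [← hmgf, mul_sum, Nat.card_eq_fintype_card, Fintype.card_subtype, card_filter]
    push_cast
    refine sum_le_sum fun f _ => ?_
    rw [← Real.exp_add]
    split_ifs with h
    · exact Real.one_le_exp (by linarith)
    · positivity
  have hc0 : 0 ≤ 1 + (Real.exp c - 1) * (#D / Fintype.card P : ℝ) := by
    have : 0 ≤ ∑ p, w p := sum_nonneg fun p _ => by simp only [hw]; split_ifs <;> positivity
    rw [hsumw] at this
    exact nonneg_of_mul_nonneg_right this hP
  unfold prob
  rw [Nat.card_eq_fintype_card (α := Fin m → P), Fintype.card_fun, Fintype.card_fin,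
    div_le_iff₀ (by positivity)]
  refine hcard.trans ?_
  rw [hsumw, mul_pow, Real.exp_add, mul_assoc, mul_comm ((Fintype.card P : ℝ) ^ m)]
  push_cast
  gcongr
  calc _ ≤ Real.exp ((Real.exp c - 1) * (#D / Fintype.card P)) ^ m := by
        gcongr
        linarith [Real.add_one_le_exp ((Real.exp c - 1) * (#D / Fintype.card P))]
    _ = _ := by rw [← Real.exp_nat_mul]; congr 1; ring

section CondSpace

variable {n m k : ℕ} {σ : Fin n → Fin k}

lemma condSpace_chernoff (D : Finset (Fin n × Fin n)) (hD : ∀ p ∈ D, σ p.1 ≠ σ p.2)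
    (hN : 0 < #{p : Fin n × Fin n | σ p.1 ≠ σ p.2}) (c T : ℝ) :
    prob (fun e : CondSpace n m k σ => c * T ≤ c * (#{t | e.1 t ∈ D} : ℝ)) ≤
      Real.exp (-(c * T) + (Real.exp c - 1) *
        (m * #D / #{p : Fin n × Fin n | σ p.1 ≠ σ p.2})) := by
  classical
  let P := {p : Fin n × Fin n // σ p.1 ≠ σ p.2}
  have hcard : Fintype.card P = #{p : Fin n × Fin n | σ p.1 ≠ σ p.2} := Fintype.card_subtype _
  have : Nonempty P := Fintype.card_pos_iff.mp (hcard ▸ hN)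
  have hDc : #(D.subtype fun p => σ p.1 ≠ σ p.2) = #D := by
    rw [card_subtype, filter_true_of_mem hD]
  have key := prob_chernoff m (D.subtype fun p => σ p.1 ≠ σ p.2) c T
  rw [hDc, Fintype.card_subtype] at key
  refine le_trans (le_of_eq ?_) key
  rw [← prob_comp_equiv (Equiv.subtypePiEquivPi (p := fun _ (p : Fin n × Fin n) => σ p.1 ≠ σ p.2))]
  simp [Equiv.subtypePiEquivPi]

lemma card_filter_color_ne (σ : Fin n → Fin k) :
    #{p : Fin n × Fin n | σ p.1 ≠ σ p.2} = ∑ u, (n - #{v | σ v = σ u}) := by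
  rw [card_filter, Fintype.sum_prod_type]
  refine sum_congr rfl fun u _ => ?_
  rw [← card_filter]
  have := card_filter_add_card_filter_not (s := (univ : Finset (Fin n))) (fun v => σ v = σ u)
  simp only [card_univ, Fintype.card_fin] at this
  simp only [ne_eq, eq_comm (a := σ u)]
  omega

/-- The ordered pairs one of whose entries is some `v ∈ S` and the other has color `J v`. -/
def pairsTo (σ : Fin n → Fin k) (S : Finset (Fin n)) (J : Fin n → Fin k) :
    Finset (Fin n × Fin n) :=
  {p | (p.1 ∈ S ∧ σ p.2 = J p.1) ∨ (p.2 ∈ S ∧ σ p.1 = J p.2)}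

lemma mem_pairsTo {S : Finset (Fin n)} {J : Fin n → Fin k} {p : Fin n × Fin n} :
    p ∈ pairsTo σ S J ↔ (p.1 ∈ S ∧ σ p.2 = J p.1) ∨ (p.2 ∈ S ∧ σ p.1 = J p.2) := by
  simp [pairsTo]

lemma color_ne_of_mem_pairsTo {S : Finset (Fin n)} {J : Fin n → Fin k} {i : Fin k}
    (hS : ∀ v ∈ S, σ v = i) (hJ : ∀ v ∈ S, J v ≠ i) : ∀ p ∈ pairsTo σ S J, σ p.1 ≠ σ p.2 := by
  intro p hp
  rcases mem_pairsTo.mp hp with ⟨h, h'⟩ | ⟨h, h'⟩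
  · rw [h', hS _ h]; exact (hJ _ h).symm
  · rw [h', hS _ h]; exact hJ _ h

lemma card_pairsTo {S : Finset (Fin n)} {J : Fin n → Fin k} {i : Fin k}
    (hS : ∀ v ∈ S, σ v = i) (hJ : ∀ v ∈ S, J v ≠ i) :
    #(pairsTo σ S J) = 2 * ∑ v ∈ S, #{u | σ u = J v} := by
  classical
  have h1 : #{p : Fin n × Fin n | p.1 ∈ S ∧ σ p.2 = J p.1} = ∑ v ∈ S, #{u | σ u = J v} := by
    rw [card_filter, Fintype.sum_prod_type, ← sum_subset (subset_univ S)]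
    · refine sum_congr rfl fun v hv => ?_
      rw [card_filter]
      simp only [hv, true_and]
    · intro v _ hv
      simp [hv]
  have h2 : #{p : Fin n × Fin n | p.2 ∈ S ∧ σ p.1 = J p.2} =
      #{p : Fin n × Fin n | p.1 ∈ S ∧ σ p.2 = J p.1} := by
    refine card_bij (fun p _ => p.swap) ?_ ?_ ?_
    · simp
    · simp
    · rintro ⟨a, b⟩ h
      exact ⟨(b, a), by simpa using h, rfl⟩
  have hdisj : Disjoint (univ.filter fun p : Fin n × Fin n => p.1 ∈ S ∧ σ p.2 = J p.1)
      (univ.filter fun p : Fin n × Fin n => p.2 ∈ S ∧ σ p.1 = J p.2) := by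
    rw [disjoint_filter]
    rintro p - ⟨h, h'⟩ ⟨h3, -⟩
    exact hJ _ h (h' ▸ hS _ h3)
  rw [pairsTo, filter_or, card_union_of_disjoint hdisj, h2, h1]
  ring

/-- The assignments to every vertex of `S` of a color other than `i` (with value `i` off `S`). -/
def colorChoices (S : Finset (Fin n)) (i : Fin k) : Finset (Fin n → Fin k) :=
  Fintype.piFinset fun v => if v ∈ S then univ.erase i else {i}

lemma mem_colorChoices {S : Finset (Fin n)} {i : Fin k} {J : Fin n → Fin k} :
    J ∈ colorChoices S i ↔ (∀ v ∈ S, J v ≠ i) ∧ ∀ v ∉ S, J v = i := by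
  simp only [colorChoices, Fintype.mem_piFinset]
  refine ⟨fun h => ⟨fun v hv => ?_, fun v hv => ?_⟩, fun h v => ?_⟩
  · simpa [hv] using h v
  · simpa [hv] using h v
  · by_cases hv : v ∈ S
    · simpa [hv] using h.1 v hv
    · simpa [hv] using h.2 v hv

lemma card_colorChoices_le (S : Finset (Fin n)) (i : Fin k) : #(colorChoices S i) ≤ k ^ #S := by
  rw [colorChoices, Fintype.card_piFinset]
  calc ∏ v, #(if v ∈ S then univ.erase i else {i}) ≤ ∏ v, if v ∈ S then k else 1 := by
        refine prod_le_prod' fun v _ => ?_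
        split_ifs
        · simp
        · simp
    _ = k ^ #S := by simp

lemma card_filter_mem_pairsTo_le (e : Fin m → Fin n × Fin n) (S : Finset (Fin n))
    (J : Fin n → Fin k) :
    #{t | e t ∈ pairsTo σ S J} ≤ ∑ v ∈ S, eSet e {v} {u | σ u = J v} := by
  classical
  have : ({t | e t ∈ pairsTo σ S J} : Finset (Fin m)) ⊆ S.biUnion fun v =>
      {t | ((e t).1 ∈ ({v} : Set (Fin n)) ∧ (e t).2 ∈ {u | σ u = J v}) ∨
        ((e t).1 ∈ {u | σ u = J v} ∧ (e t).2 ∈ ({v} : Set (Fin n)))} := by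
    intro t ht
    simp only [mem_filter, mem_univ, true_and, mem_pairsTo] at ht
    simp only [mem_biUnion, mem_filter, mem_univ, true_and, Set.mem_singleton_iff,
      Set.mem_ofPred_eq]
    rcases ht with ⟨h, h'⟩ | ⟨h, h'⟩
    · exact ⟨_, h, .inl ⟨rfl, h'⟩⟩
    · exact ⟨_, h, .inr ⟨h', rfl⟩⟩
  refine (card_le_card this).trans (card_biUnion_le.trans (sum_le_sum fun v _ => ?_))
  rw [eSet, Nat.card_eq_fintype_card, Fintype.card_subtype]

lemma eSet_le_card_filter_mem_pairsTo (e : Fin m → Fin n × Fin n) (A : Set (Fin n))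
    (S : Finset (Fin n)) (hA : A ⊆ S) (j : Fin k) :
    eSet e A {v | σ v = j} ≤ #{t | e t ∈ pairsTo σ S fun _ => j} := by
  classical
  rw [eSet, Nat.card_eq_fintype_card, Fintype.card_subtype]
  refine card_le_card fun t ht => ?_
  simp only [mem_filter, mem_univ, true_and, mem_pairsTo, Set.mem_ofPred_eq] at ht ⊢
  rcases ht with ⟨h, h'⟩ | ⟨h, h'⟩
  · exact .inl ⟨hA h, h'⟩
  · exact .inr ⟨hA h', h⟩

/-- If many vertices of color `i` have few neighbours in some other class, then some `S` of size
`s` does; otherwise `W_i` is contained in a set of size `s` with many edges into class `j`. -/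
lemma exists_witness (e : Fin m → Fin n × Fin n) {i j : Fin k} {s : ℕ} {T : ℝ}
    (hs : s ≤ #{v | σ v = i}) (hT : T ≤ (eSet e (Wset σ e i) {v | σ v = j} : ℝ)) :
    ∃ S ∈ powersetCard s {v | σ v = i},
      (∃ J ∈ colorChoices S i, (#{t | e t ∈ pairsTo σ S J} : ℝ) ≤ 3 * ell k * s) ∨
      T ≤ (#{t | e t ∈ pairsTo σ S fun _ => j} : ℝ) := by
  classical
  set W : Finset (Fin n) := {v | v ∈ Wset σ e i} with hW
  have hWV : W ⊆ ({v | σ v = i} : Finset (Fin n)) := by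
    intro v hv
    simp only [hW, mem_filter, mem_univ, true_and] at hv ⊢
    exact hv.1
  rcases le_total s #W with h | h
  · obtain ⟨S, hSW, hSc⟩ := exists_subset_card_eq h
    refine ⟨S, mem_powersetCard.mpr ⟨hSW.trans hWV, hSc⟩, .inl ?_⟩
    have hmem : ∀ v ∈ S, ∃ j : Fin k, j ≠ i ∧ (eSet e {v} {u | σ u = j} : ℝ) < 3 * ell k := by
      intro v hv
      have := hSW hv
      simp only [hW, mem_filter, mem_univ, true_and] at this
      exact this.2
    let J : Fin n → Fin k := fun v => if hv : v ∈ S then (hmem v hv).choose else i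
    have hJ : ∀ v ∈ S, J v ≠ i ∧ (eSet e {v} {u | σ u = J v} : ℝ) < 3 * ell k := by
      intro v hv
      simp only [J, hv, dif_pos]
      exact (hmem v hv).choose_spec
    refine ⟨J, mem_colorChoices.mpr ⟨fun v hv => (hJ v hv).1, fun v hv => dif_neg hv⟩, ?_⟩
    calc (#{t | e t ∈ pairsTo σ S J} : ℝ)
        ≤ ∑ v ∈ S, (eSet e {v} {u | σ u = J v} : ℝ) := by
          exact_mod_cast card_filter_mem_pairsTo_le e S J
      _ ≤ ∑ v ∈ S, 3 * ell k := sum_le_sum fun v hv => (hJ v hv).2.le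
      _ = 3 * ell k * s := by rw [sum_const, hSc, nsmul_eq_mul, mul_comm]
  · obtain ⟨S, hWS, hSV, hSc⟩ := exists_subsuperset_card_eq hWV h hs
    refine ⟨S, mem_powersetCard.mpr ⟨hSV, hSc⟩, .inr (hT.trans ?_)⟩
    rw [Nat.cast_le]
    refine eSet_le_card_filter_mem_pairsTo e _ S ?_ j
    intro v hv
    exact hWS (by simpa [hW] using hv)

/-- If all classes have size within 1% of `n / k`, then the pair count is between `n² / 2` and
`n²`. -/
lemma card_filter_color_ne_bounds (hk : (100 : ℝ) ≤ k)
    (hc : ∀ i, |(#{v | σ v = i} : ℝ) - n / k| ≤ n / k / 100) :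
    (n : ℝ) ^ 2 / 2 ≤ #{p : Fin n × Fin n | σ p.1 ≠ σ p.2} ∧
      (#{p : Fin n × Fin n | σ p.1 ≠ σ p.2} : ℝ) ≤ (n : ℝ) ^ 2 := by
  have hsum : (#{p : Fin n × Fin n | σ p.1 ≠ σ p.2} : ℝ) =
      ∑ u : Fin n, ((n : ℝ) - #{v | σ v = σ u}) := by
    rw [card_filter_color_ne, Nat.cast_sum]
    refine sum_congr rfl fun u _ => ?_
    rw [Nat.cast_sub]
    simpa using card_le_univ ({v | σ v = σ u} : Finset (Fin n))
  rw [hsum]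
  have hnk : (n : ℝ) / k ≤ n / 100 := by gcongr
  constructor
  · calc (n : ℝ) ^ 2 / 2 = ∑ u : Fin n, (n : ℝ) / 2 := by simp; ring
      _ ≤ _ := by
        gcongr with u
        have := (abs_le.mp (hc (σ u))).2
        have : (0 : ℝ) ≤ n := by positivity
        linarith
  · calc _ ≤ ∑ u : Fin n, (n : ℝ) := by gcongr with u; simp
      _ = _ := by simp; ring

/-- The expected number of edges in `pairsTo σ S J` is of order `|S| log k`. -/
lemma mean_pairsTo_bounds {S : Finset (Fin n)} {J : Fin n → Fin k} {i : Fin k} {L : ℝ}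
    (hS : ∀ v ∈ S, σ v = i) (hJ : ∀ v ∈ S, J v ≠ i) (hn : 0 < n) (hk : (100 : ℝ) ≤ k)
    (hL : 0 < L) (hc : ∀ i, |(#{v | σ v = i} : ℝ) - n / k| ≤ n / k / 100)
    (hm : 99 / 100 * (n * k * L) ≤ m) (hm' : (m : ℝ) ≤ 2 * (n * k * L)) :
    49 / 25 * (L * #S) ≤ m * #(pairsTo σ S J) / #{p : Fin n × Fin n | σ p.1 ≠ σ p.2} ∧
      (m * #(pairsTo σ S J) / #{p : Fin n × Fin n | σ p.1 ≠ σ p.2} : ℝ) ≤ 9 * (L * #S) := by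
  obtain ⟨hN, hN'⟩ := card_filter_color_ne_bounds hk hc
  have hn' : (0 : ℝ) < n := by exact_mod_cast hn
  have hk' : (0 : ℝ) < k := by linarith
  have hD : (#(pairsTo σ S J) : ℝ) = 2 * ∑ v ∈ S, (#{u | σ u = J v} : ℝ) := by
    rw [card_pairsTo hS hJ]; push_cast; rfl
  have hDl : 2 * (#S * (99 / 100 * (n / k))) ≤ (#(pairsTo σ S J) : ℝ) := by
    rw [hD]
    gcongr
    rw [← nsmul_eq_mul]
    refine card_nsmul_le_sum _ _ _ fun v _ => ?_
    have := (abs_le.mp (hc (J v))).1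
    linarith
  have hDu : (#(pairsTo σ S J) : ℝ) ≤ 2 * (#S * (101 / 100 * (n / k))) := by
    rw [hD]
    gcongr
    rw [← nsmul_eq_mul]
    refine sum_le_card_nsmul _ _ _ fun v _ => ?_
    have := (abs_le.mp (hc (J v))).2
    linarith
  have hS0 : 0 ≤ L * #S := by positivity
  constructor
  · calc 49 / 25 * (L * #S) ≤ 2 * (99 / 100) ^ 2 * (L * #S) := by gcongr; norm_num
      _ = 99 / 100 * (n * k * L) * (2 * (#S * (99 / 100 * (n / k)))) / n ^ 2 := by field_simp
      _ ≤ _ := by gcongr; exact lt_of_lt_of_le (by positivity) hN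
  · calc _ ≤ 2 * (n * k * L) * (2 * (#S * (101 / 100 * (n / k)))) / ((n : ℝ) ^ 2 / 2) := by
          gcongr
      _ = 808 / 100 * (L * #S) := by field_simp; ring
      _ ≤ _ := by gcongr; norm_num

lemma ell_le : ell k ≤ Real.log k / 300 := by
  have h : (300 : ℝ) ≤ Real.exp 7 := by
    have h1 : (2.7 : ℝ) ≤ Real.exp 1 := by linarith [Real.exp_one_gt_d9]
    have h2 : Real.exp 7 = Real.exp 1 ^ 7 := by rw [← Real.exp_nat_mul]; norm_num
    rw [h2]
    calc (300 : ℝ) ≤ 2.7 ^ 7 := by norm_num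
      _ ≤ _ := by gcongr
  have hl : 0 ≤ Real.log k := Real.log_natCast_nonneg k
  rw [ell, Real.exp_neg, inv_mul_eq_div]
  gcongr

/-- The event in question, for a fixed pair of colors. -/
lemma prob_pair_le {i j : Fin k} (hij : i ≠ j) (hn : 0 < n) (hk : (100 : ℝ) ≤ k)
    (hL : 0 < Real.log k) (hLL : 1000 ≤ Real.log (Real.log k))
    (hnk : Real.log k ≤ n / k) (hL3 : 1000 ≤ Real.log k)
    (hc : ∀ i, |(#{v | σ v = i} : ℝ) - n / k| ≤ n / k / 100)
    (hm : 99 / 100 * (n * k * Real.log k) ≤ m) (hm' : (m : ℝ) ≤ 2 * (n * k * Real.log k)) :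
    prob (fun e : CondSpace n m k σ => 2 * n * Real.log (Real.log k) / k ≤
        (eSet e.1 (Wset σ e.1 i) {v | σ v = j} : ℝ)) ≤ 2 * Real.exp (-13 * (n / k)) := by
  set L := Real.log k with hLdef
  set x : ℝ := n / k with hx
  have hk0 : (0 : ℝ) < k := by linarith
  have hN : 0 < #{p : Fin n × Fin n | σ p.1 ≠ σ p.2} := by
    have := (card_filter_color_ne_bounds hk hc).1
    have hn' : (0 : ℝ) < n := by exact_mod_cast hn
    exact Nat.cast_pos.mp (lt_of_lt_of_le (show 0 < (n : ℝ) ^ 2 / 2 by positivity) this)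
  set s : ℕ := ⌈100 * x / L⌉₊ with hs
  have hs1 : 100 * x ≤ L * s := by
    have := Nat.le_ceil (100 * x / L)
    rw [div_le_iff₀ hL] at this
    linarith
  have hs2 : s ≤ 100 * x / L + 1 := (Nat.ceil_lt_add_one (by positivity)).le
  have hs3 : L * s ≤ 101 * x := by
    calc L * s ≤ L * (100 * x / L + 1) := by gcongr
      _ = 100 * x + L := by field_simp
      _ ≤ _ := by linarith
  have hsV : s ≤ #{v | σ v = i} := by
    have h1 := (abs_le.mp (hc i)).1
    have h2 : 100 * x / L ≤ 100 * x / 1000 := by gcongr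
    have : (s : ℝ) ≤ #{v | σ v = i} := by linarith
    exact_mod_cast this
  have hcount : (#(powersetCard s ({v | σ v = i} : Finset (Fin n))) : ℝ) ≤ Real.exp (2 * x) := by
    have h1 : #(powersetCard s ({v | σ v = i} : Finset (Fin n))) ≤ 2 ^ #{v | σ v = i} := by
      rw [card_powersetCard]
      exact Nat.choose_le_two_pow _ _
    have h2 := (abs_le.mp (hc i)).2
    calc (#(powersetCard s ({v | σ v = i} : Finset (Fin n))) : ℝ) ≤ 2 ^ #{v | σ v = i} := by
          exact_mod_cast h1
      _ ≤ Real.exp 1 ^ #{v | σ v = i} := by gcongr; linarith [Real.exp_one_gt_d9]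
      _ = Real.exp #{v | σ v = i} := by rw [← Real.exp_nat_mul, mul_one]
      _ ≤ _ := by gcongr; linarith
  have hkL : (k : ℝ) = Real.exp L := (Real.exp_log hk0).symm
  have hlow : ∀ S ∈ powersetCard s ({v | σ v = i} : Finset (Fin n)), ∀ J ∈ colorChoices S i,
      prob (fun e : CondSpace n m k σ => (#{t | e.1 t ∈ pairsTo σ S J} : ℝ) ≤ 3 * ell k * s) ≤
        Real.exp (-(6 / 5) * (L * s)) := by
    intro S hS J hJ
    obtain ⟨hSV, hSc⟩ := mem_powersetCard.mp hS
    have hSi : ∀ v ∈ S, σ v = i := fun v hv => (mem_filter.mp (hSV hv)).2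
    have hJi := (mem_colorChoices.mp hJ).1
    have hmean := (mean_pairsTo_bounds hSi hJi hn hk hL hc hm hm').1
    have := condSpace_chernoff (m := m) _ (color_ne_of_mem_pairsTo hSi hJi) hN (-1) (3 * ell k * s)
    simp only [neg_mul, one_mul, neg_le_neg_iff, neg_neg] at this
    refine this.trans (Real.exp_le_exp.mpr ?_)
    rw [hSc] at hmean
    have h1 : Real.exp (-1) - 1 ≤ -(63 / 100) := by linarith [Real.exp_neg_one_lt_d9]
    have h2 := mul_le_mul_of_nonneg_right h1 (le_trans (by positivity) hmean)
    have h3 : ell k * s ≤ L / 300 * s := by gcongr; exact ell_le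
    linarith
  have hup : ∀ S ∈ powersetCard s ({v | σ v = i} : Finset (Fin n)),
      prob (fun e : CondSpace n m k σ => 2 * n * Real.log L / k ≤
        (#{t | e.1 t ∈ pairsTo σ S fun _ => j} : ℝ)) ≤ Real.exp (-15 * x) := by
    intro S hS
    obtain ⟨hSV, hSc⟩ := mem_powersetCard.mp hS
    have hSi : ∀ v ∈ S, σ v = i := fun v hv => (mem_filter.mp (hSV hv)).2
    have hJi : ∀ v ∈ S, (fun _ : Fin n => j) v ≠ i := fun _ _ => hij.symm
    obtain ⟨hmean0, hmean⟩ := mean_pairsTo_bounds hSi hJi hn hk hL hc hm hm'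
    have := condSpace_chernoff (m := m) _ (color_ne_of_mem_pairsTo hSi hJi) hN 1
      (2 * n * Real.log L / k)
    simp only [one_mul] at this
    refine this.trans (Real.exp_le_exp.mpr ?_)
    rw [hSc] at hmean
    have h1 : Real.exp 1 - 1 ≤ 2 := by linarith [Real.exp_one_lt_d9]
    have h0 : 0 ≤ 49 / 25 * (L * #S) :=
      mul_nonneg (by norm_num) (mul_nonneg hL.le (Nat.cast_nonneg _))
    have h2 := mul_le_mul_of_nonneg_right h1 (h0.trans hmean0)
    have h3 : 2 * x * 1000 ≤ 2 * x * Real.log L := by gcongr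
    have h4 : 2 * n * Real.log L / k = 2 * x * Real.log L := by rw [hx]; ring
    linarith
  have hbound : ∀ S ∈ powersetCard s ({v | σ v = i} : Finset (Fin n)),
      prob (fun e : CondSpace n m k σ =>
        (∃ J ∈ colorChoices S i, (#{t | e.1 t ∈ pairsTo σ S J} : ℝ) ≤ 3 * ell k * s) ∨
          2 * n * Real.log L / k ≤ (#{t | e.1 t ∈ pairsTo σ S fun _ => j} : ℝ)) ≤
        2 * Real.exp (-15 * x) := by
    intro S hS
    refine (prob_or_le _ _).trans ?_
    rw [two_mul (Real.exp _)]
    refine add_le_add ?_ (hup S hS)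
    refine (prob_exists_mem_le_card_mul _ _ _ (hlow S hS)).trans ?_
    have hch : (#(colorChoices S i) : ℝ) ≤ Real.exp (L * s) := by
      have h1 : (#(colorChoices S i) : ℝ) ≤ (k : ℝ) ^ s := by
        rw [← (mem_powersetCard.mp hS).2]
        exact_mod_cast card_colorChoices_le S i
      rw [hkL, ← Real.exp_nat_mul, mul_comm] at h1
      exact h1
    calc _ ≤ Real.exp (L * s) * Real.exp (-(6 / 5) * (L * s)) := by gcongr
      _ ≤ _ := by
        rw [← Real.exp_add]
        gcongr
        linarith
  calc _ ≤ _ := prob_mono fun e he => exists_witness e.1 hsV he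
    _ ≤ _ := prob_exists_mem_le_card_mul _ _ _ hbound
    _ ≤ Real.exp (2 * x) * (2 * Real.exp (-15 * x)) := by gcongr
    _ = 2 * (Real.exp (2 * x) * Real.exp (-15 * x)) := by ring
    _ = _ := by rw [← Real.exp_add]; congr 2; ring

end CondSpace

theorem statement12 :
    ∃ k₀ : ℕ, ∀ k : ℕ, k₀ ≤ k → ∀ d : ℝ,
      2 * k * Real.log k - Real.log k - 4 ≤ d → d ≤ 2 * k * Real.log k →
      ∃ n₀ : ℕ, ∀ n : ℕ, n₀ ≤ n → ∀ σ : Fin n → Fin k, NearBalanced n k σ →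
        prob (fun e : CondSpace n ⌈d * n / 2⌉₊ k σ =>
            ∃ i j : Fin k, i < j ∧
              2 * n * Real.log (Real.log k) / k ≤
                (eSet e.1 (Wset σ e.1 i) {v | σ v = j} : ℝ))
          ≤ Real.exp (-11 * n / k) := by
  have hlog : Filter.Tendsto (fun k : ℕ => Real.log k) Filter.atTop Filter.atTop :=
    Real.tendsto_log_atTop.comp tendsto_natCast_atTop_atTop
  obtain ⟨k₀, hk₀⟩ := Filter.eventually_atTop.mp
    ((tendsto_natCast_atTop_atTop.eventually_ge_atTop (1000 : ℝ)).and
      ((hlog.eventually_ge_atTop (10 ^ 6)).and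
        ((Real.tendsto_log_atTop.comp hlog).eventually_ge_atTop 1000)))
  refine ⟨k₀, fun k hk d hd hd' => ?_⟩
  obtain ⟨hk3, hL6, hLL⟩ := hk₀ k hk
  simp only [Function.comp_apply] at hLL
  set L := Real.log k with hL
  have hL0 : 0 < L := by linarith
  have hk0 : (0 : ℝ) < k := by linarith
  refine ⟨⌈k * (L + 1)⌉₊, fun n hn σ hσ => ?_⟩
  have hn1 : k * (L + 1) ≤ (n : ℝ) := Nat.ceil_le.mp hn
  have hn0 : (0 : ℝ) < n := lt_of_lt_of_le (by positivity) hn1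
  have hx : L + 1 ≤ (n : ℝ) / k := by rwa [le_div_iff₀ hk0, mul_comm]
  have hc : ∀ i, |(#{v | σ v = i} : ℝ) - n / k| ≤ n / k / 100 := by
    intro i
    have h := hσ i
    rw [Nat.card_eq_fintype_card, Fintype.card_subtype] at h
    refine h.trans ?_
    rw [div_div]
    gcongr
    calc (100 : ℝ) = ((10 : ℝ) ^ 6) ^ ((1 : ℝ) / 3) := by
          rw [← Real.rpow_natCast, ← Real.rpow_mul (by norm_num)]; norm_num
      _ ≤ _ := by gcongr
  have hnL : 0 ≤ n * L := by positivity
  have hm : 99 / 100 * (n * k * L) ≤ (⌈d * n / 2⌉₊ : ℝ) := by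
    refine le_trans ?_ (Nat.le_ceil _)
    have h1 : (2 * k * L - L - 4) * n ≤ d * n := by gcongr
    nlinarith [mul_le_mul_of_nonneg_left hk3 hnL]
  have hd0 : 0 ≤ d := by nlinarith
  have hm' : (⌈d * n / 2⌉₊ : ℝ) ≤ 2 * (n * k * L) := by
    refine (Nat.ceil_lt_add_one (by positivity)).le.trans ?_
    have h1 : d * n ≤ 2 * k * L * n := by gcongr
    have h2 : 1 ≤ n * k * L := by
      have : (1 : ℝ) ≤ n := by nlinarith
      nlinarith [mul_le_mul_of_nonneg_left hk3 hnL]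
    linarith
  have hpair : ∀ q ∈ ({q | q.1 < q.2} : Finset (Fin k × Fin k)), _ := fun q hq =>
    prob_pair_le (σ := σ) (m := ⌈d * n / 2⌉₊) (i := q.1) (j := q.2)
      (by simpa using (mem_filter.mp hq).2.ne) (by exact_mod_cast hn0) (by linarith) hL0 hLL
      (by linarith) (by linarith) hc hm hm'
  calc _ ≤ _ := prob_mono (q := fun e => ∃ q ∈ ({q | q.1 < q.2} : Finset (Fin k × Fin k)), _) <| by
        rintro e ⟨i, j, hij, h⟩
        exact ⟨(i, j), by simpa using hij, h⟩
    _ ≤ _ := prob_exists_mem_le_card_mul _ _ _ hpair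
    _ ≤ (k : ℝ) ^ 2 * (2 * Real.exp (-13 * (n / k))) := by
        gcongr
        have := card_le_univ ({q | q.1 < q.2} : Finset (Fin k × Fin k))
        rw [Fintype.card_prod, Fintype.card_fin, ← sq] at this
        exact_mod_cast this
    _ = 2 * Real.exp L ^ 2 * Real.exp (-13 * (n / k)) := by rw [hL, Real.exp_log hk0]; ring
    _ ≤ Real.exp (2 * (n / k)) * Real.exp (-13 * (n / k)) := by
        gcongr
        calc 2 * Real.exp L ^ 2 ≤ Real.exp 1 ^ 2 * Real.exp L ^ 2 := by
              gcongr; nlinarith [Real.exp_one_gt_d9]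
          _ = Real.exp (2 * (L + 1)) := by
              rw [← mul_pow, ← Real.exp_add, ← Real.exp_nat_mul]; congr 1; push_cast; ring
          _ ≤ _ := by gcongr
    _ = _ := by rw [← Real.exp_add]; congr 1; ring
end

section
/- There is a constant k_0 ∈ ℕ such that for every k ≥ k_0 and every d with 2k·ln k − ln k − 4 ≤ d ≤ 2k·ln k, the following holds for all sufficiently large n and every near-balanced σ: V → {1,...,k}: in the random multigraph G'(σ), P[|U| > n·ln ln k/(k·ln k)] ≤ exp(−10n/k). -/
/-- Union bound for counting. -/
lemma card_exists_le_sum {Ω γ : Type*} [Finite Ω] [Fintype γ] (P : γ → Ω → Prop) :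
    Nat.card {x // ∃ c, P c x} ≤ ∑ c, Nat.card {x // P c x} := by
  rw [← Nat.card_sigma]
  refine Nat.card_le_card_of_injective
    (fun x => (⟨x.2.choose, x.1, x.2.choose_spec⟩ : Σ c, {x // P c x})) fun x y hxy => ?_
  have h := congrArg (fun z : (Σ c, {x // P c x}) => z.2.1) hxy
  exact Subtype.ext h

lemma card_exists_le {Ω γ : Type*} [Finite Ω] [Finite γ] (P : γ → Ω → Prop) {B : ℝ}
    (h : ∀ c, (Nat.card {x // P c x} : ℝ) ≤ B) :
    (Nat.card {x // ∃ c, P c x} : ℝ) ≤ Nat.card γ * B := by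
  have := Fintype.ofFinite γ
  calc (Nat.card {x // ∃ c, P c x} : ℝ) ≤ ∑ c, (Nat.card {x // P c x} : ℝ) := by
        exact_mod_cast card_exists_le_sum P
    _ ≤ ∑ _c : γ, B := Finset.sum_le_sum fun c _ => h c
    _ = Nat.card γ * B := by simp

lemma card_or_le {Ω : Type*} [Finite Ω] (P Q : Ω → Prop) :
    Nat.card {x // P x ∨ Q x} ≤ Nat.card {x // P x} + Nat.card {x // Q x} := by
  have := Fintype.ofFinite Ω
  classical
  simpa only [Nat.card_eq_fintype_card] using Fintype.card_subtype_or P Q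

lemma card_mono {Ω : Type*} [Finite Ω] {P Q : Ω → Prop} (h : ∀ x, P x → Q x) :
    Nat.card {x // P x} ≤ Nat.card {x // Q x} :=
  Nat.card_le_card_of_injective _ (Subtype.map_injective h Function.injective_id)

open scoped Classical in
/-- Chernoff bound for the lower tail of the number of samples that hit `D`. -/
lemma card_few_hits_le {ι E : Type*} [Finite ι] [Finite E] (D : E → Prop) {s y : ℝ} (hs : 0 ≤ s) :
    (Nat.card {g : ι → E // (Nat.card {t // D (g t)} : ℝ) ≤ y} : ℝ) ≤
      (Nat.card E : ℝ) ^ Nat.card ι *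
        Real.exp (-(1 - Real.exp (-s)) * (Nat.card {a // D a} / Nat.card E) * Nat.card ι + s * y) := by
  have := Fintype.ofFinite ι
  have := Fintype.ofFinite E
  rcases isEmpty_or_nonempty E with hE | hE
  · rcases isEmpty_or_nonempty ι with hι | hι
    · by_cases hy : 0 ≤ y
      · simp only [Nat.card_of_isEmpty]
        simp [hy, mul_nonneg hs hy]
      · simp [hy, Real.exp_nonneg]
    · simp
  have hEpos : (0 : ℝ) < Fintype.card E := by exact_mod_cast Fintype.card_pos
  let w : E → ℝ := fun a => if D a then Real.exp (-s) else 1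
  have hw : ∀ g : ι → E, ∏ t, w (g t) = Real.exp (-s * Nat.card {t // D (g t)}) := by
    intro g
    simp only [w]
    rw [Finset.prod_ite]
    rw [Finset.prod_const, Finset.prod_const_one, mul_one]
    rw [← Real.exp_nat_mul, Nat.card_eq_fintype_card, Fintype.card_subtype]
    ring_nf
  have hsum : ∑ a, w a = Fintype.card E - Nat.card {a // D a} * (1 - Real.exp (-s)) := by
    have : ∀ a, w a = 1 - (if D a then 1 - Real.exp (-s) else 0) := by
      intro a; simp only [w]; split_ifs <;> ring
    simp_rw [this, Finset.sum_sub_distrib, Finset.sum_ite]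
    simp [Nat.card_eq_fintype_card, Fintype.card_subtype, mul_sub]
  have hmgf : ∑ g : ι → E, ∏ t, w (g t) = (∑ a, w a) ^ Fintype.card ι := by
    have := Finset.prod_univ_sum (fun _ : ι => (Finset.univ : Finset E)) (fun _ a => w a)
    rw [Fintype.piFinset_univ] at this
    rw [← this]; simp
  have hpow : (∑ a, w a) ^ Fintype.card ι ≤ (Fintype.card E : ℝ) ^ Fintype.card ι *
      Real.exp (-(1 - Real.exp (-s)) * (Nat.card {a // D a} / Nat.card E) * Nat.card ι) := by
    have h1 : ∑ a, w a ≤ Fintype.card E *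
        Real.exp (-(1 - Real.exp (-s)) * (Nat.card {a // D a} / Fintype.card E)) := by
      rw [hsum]
      have := Real.add_one_le_exp (-(1 - Real.exp (-s)) * (Nat.card {a // D a} / Fintype.card E))
      calc _ = (Fintype.card E : ℝ) * (-(1 - Real.exp (-s)) * (Nat.card {a // D a} / Fintype.card E) + 1) := by
            field_simp; ring
        _ ≤ _ := mul_le_mul_of_nonneg_left this hEpos.le
    have h0 : 0 ≤ ∑ a, w a :=
      Finset.sum_nonneg fun a _ => by simp only [w]; split_ifs <;> positivity
    calc _ ≤ _ := pow_le_pow_left₀ h0 h1 _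
      _ = _ := by
        rw [mul_pow, ← Real.exp_nat_mul, Nat.card_eq_fintype_card, Nat.card_eq_fintype_card]
        congr 2; rw [Nat.card_eq_fintype_card]; ring
  have hmain : (Nat.card {g : ι → E // (Nat.card {t // D (g t)} : ℝ) ≤ y} : ℝ) ≤
      Real.exp (s * y) * ∑ g : ι → E, ∏ t, w (g t) := by
    rw [Nat.card_eq_fintype_card, Fintype.card_subtype, Finset.card_filter, Finset.mul_sum,
      Nat.cast_sum]
    refine Finset.sum_le_sum fun g _ => ?_
    rw [hw, ← Real.exp_add]
    split_ifs with h
    · rw [Nat.cast_one]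
      apply Real.one_le_exp
      nlinarith
    · rw [Nat.cast_zero]
      positivity
  calc _ ≤ _ := hmain
    _ ≤ _ := mul_le_mul_of_nonneg_left (hmgf.le.trans hpow) (Real.exp_nonneg _)
    _ = _ := by rw [Real.exp_add, Nat.card_eq_fintype_card (α := E), Nat.card_eq_fintype_card (α := ι)]; ring

open scoped Classical in
/-- If each coordinate in `F` is confined to a set of size at most `B` determined by the coordinates
outside `F`, then `F` contributes at most `B ^ #F` to the count. -/
lemma card_confined_le {ι E : Type*} [Finite ι] [Finite E] (F : Finset ι)
    (Q : ({t // t ∉ F} → E) → Prop) (R : ({t // t ∉ F} → E) → ι → E → Prop) {B : ℝ}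
    (hB : ∀ g, Q g → ∀ t ∈ F, (Nat.card {a // R g t a} : ℝ) ≤ B) :
    (Nat.card {f : ι → E // Q (fun t => f t) ∧ ∀ t ∈ F, R (fun t => f t) t (f t)} : ℝ) ≤
      Nat.card {g // Q g} * B ^ F.card := by
  have := Fintype.ofFinite E
  have := Fintype.ofFinite ι
  let P := {f : ι → E // Q (fun t => f t) ∧ ∀ t ∈ F, R (fun t => f t) t (f t)}
  let φ : P → Σ g : {g // Q g}, ∀ t : F, {a // R g.1 t a} :=
    fun f => ⟨⟨fun t => f.1 t, f.2.1⟩, fun t => ⟨f.1 t, f.2.2 t t.2⟩⟩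
  have hφ : Function.Injective φ := by
    rintro ⟨f, hf⟩ ⟨f', hf'⟩ h
    have h1 : (fun t : {t // t ∉ F} => f t.1) = fun t => f' t.1 :=
      congrArg (fun z : Σ g : {g // Q g}, ∀ t : F, {a // R g.1 t a} => z.1.1) h
    have h2 : (fun t : F => f t.1) = fun t => f' t.1 :=
      congrArg (fun (z : Σ g : {g // Q g}, ∀ t : F, {a // R g.1 t a}) t => (z.2 t).1) h
    refine Subtype.ext (funext fun t => ?_)
    by_cases ht : t ∈ F
    · exact congrFun h2 ⟨t, ht⟩
    · exact congrFun h1 ⟨t, ht⟩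
  have h1 := Nat.card_le_card_of_injective φ hφ
  rw [Nat.card_sigma] at h1
  calc (Nat.card P : ℝ) ≤ ∑ g : {g // Q g}, (Nat.card (∀ t : F, {a // R g.1 t a}) : ℝ) := by
        exact_mod_cast h1
    _ ≤ ∑ _g : {g // Q g}, B ^ F.card := by
        refine Finset.sum_le_sum fun g _ => ?_
        rw [Nat.card_pi]
        push_cast
        calc ∏ t : F, (Nat.card {a // R g.1 t a} : ℝ) ≤ ∏ _t : F, B :=
              Finset.prod_le_prod (fun _ _ => by positivity) fun t _ => hB g.1 g.2 t t.2
          _ = B ^ F.card := by simp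
    _ = _ := by simp

/-- The ordered pairs of vertices with different colors. -/
abbrev Bichrom {V κ : Type*} (σ : V → κ) : Type _ := {p : V × V // σ p.1 ≠ σ p.2}

/-- `eSet` for an arbitrary index type of edges. -/
noncomputable def edgeCount {ι V : Type*} (e : ι → V × V) (A B : Set V) : ℕ :=
  Nat.card {t : ι // ((e t).1 ∈ A ∧ (e t).2 ∈ B) ∨ ((e t).1 ∈ B ∧ (e t).2 ∈ A)}

/-- The vertices of color `i` with fewer than `θ` edges to some other color class. -/
def weakSet {ι V κ : Type*} (σ : V → κ) (θ : ℝ) (e : ι → V × V) (i : κ) : Set V :=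
  {v | σ v = i ∧ ∃ j : κ, j ≠ i ∧ (edgeCount e {v} {u | σ u = j} : ℝ) < θ}

lemma edgeCount_comp_le {ι ι' V : Type*} [Finite ι] (e : ι → V × V) (r : ι' → ι)
    (hr : Function.Injective r) (A B : Set V) :
    edgeCount (fun t => e (r t)) A B ≤ edgeCount e A B := by
  have : Finite ι' := Finite.of_injective r hr
  refine Nat.card_le_card_of_injective (fun t => ⟨r t.1, t.2⟩) fun t t' h => ?_
  exact Subtype.ext (hr (congrArg Subtype.val h))

lemma weakSet_subset_comp {ι ι' V κ : Type*} [Finite ι] (σ : V → κ) (θ : ℝ) (e : ι → V × V)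
    (r : ι' → ι) (hr : Function.Injective r) (i : κ) :
    weakSet σ θ e i ⊆ weakSet σ θ (fun t => e (r t)) i := by
  rintro v ⟨hv, j, hj, h⟩
  exact ⟨hv, j, hj, lt_of_le_of_lt (by exact_mod_cast edgeCount_comp_le e r hr _ _) h⟩

open scoped Classical in
lemma card_touching_pairs_ge {V κ : Type*} [Finite V] (σ : V → κ) (S : Finset V) (j : κ)
    (hS : ∀ w ∈ S, σ w = j) (l : V → κ) (hl : ∀ w ∈ S, l w ≠ j) {a : ℝ}
    (ha : ∀ c, a ≤ (Nat.card {v // σ v = c} : ℝ)) :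
    2 * (S.card * a) ≤ (Nat.card {p : Bichrom σ // (p.1.1 ∈ S ∧ σ p.1.2 = l p.1.1) ∨
      (p.1.2 ∈ S ∧ σ p.1.1 = l p.1.2)} : ℝ) := by
  let T := Σ w : S, {u // σ u = l w}
  let D : Type _ := {p : Bichrom σ // (p.1.1 ∈ S ∧ σ p.1.2 = l p.1.1) ∨
      (p.1.2 ∈ S ∧ σ p.1.1 = l p.1.2)}
  have hne : ∀ z : T, σ z.1.1 ≠ σ z.2.1 := fun z => by
    rw [hS _ z.1.2, z.2.2]; exact (hl _ z.1.2).symm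
  let φ : T ⊕ T → D := Sum.elim
    (fun z => ⟨⟨(z.1.1, z.2.1), hne z⟩, Or.inl ⟨z.1.2, z.2.2⟩⟩)
    (fun z => ⟨⟨(z.2.1, z.1.1), (hne z).symm⟩, Or.inr ⟨z.1.2, z.2.2⟩⟩)
  have hφ : Function.Injective φ := by
    refine Function.Injective.sumElim ?_ ?_ ?_
    · rintro ⟨⟨w, hw⟩, u, hu⟩ ⟨⟨w', hw'⟩, u', hu'⟩ h
      simp only at h
      obtain ⟨rfl, rfl⟩ := h
      rfl
    · rintro ⟨⟨w, hw⟩, u, hu⟩ ⟨⟨w', hw'⟩, u', hu'⟩ h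
      simp only at h
      obtain ⟨rfl, rfl⟩ := h
      rfl
    · rintro ⟨⟨w, hw⟩, u, hu⟩ ⟨⟨w', hw'⟩, u', hu'⟩ h
      simp only at h
      obtain ⟨rfl, rfl⟩ := h
      exact hl _ hw (hu.symm.trans (hS _ hw'))
  have h1 := Nat.card_le_card_of_injective φ hφ
  rw [Nat.card_sum] at h1
  have h2 : (S.card : ℝ) * a ≤ Nat.card T := by
    rw [Nat.card_sigma]
    push_cast
    calc (S.card : ℝ) * a = ∑ _w : S, a := by simp
      _ ≤ _ := Finset.sum_le_sum fun w _ => ha _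
  have h3 : (Nat.card T : ℝ) + Nat.card T ≤ Nat.card D := by exact_mod_cast h1
  change _ ≤ (Nat.card D : ℝ)
  linarith

open scoped Classical in
lemma card_weak_of_le {ι V κ : Type*} [Finite ι] [Finite V] (σ : V → κ) (S : Finset V) (j : κ)
    (hS : ∀ w ∈ S, σ w = j) (l : V → κ) (hl : ∀ w ∈ S, l w ≠ j) {a θ s : ℝ} (hs : 0 ≤ s)
    (ha : ∀ c, a ≤ (Nat.card {v // σ v = c} : ℝ)) :
    (Nat.card {g : ι → Bichrom σ //
        ∀ w ∈ S, (edgeCount (fun t => (g t).1) {w} {u | σ u = l w} : ℝ) < θ} : ℝ) ≤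
      (Nat.card (Bichrom σ) : ℝ) ^ Nat.card ι *
        Real.exp (-(1 - Real.exp (-s)) * (2 * (S.card * a) / Nat.card (Bichrom σ)) * Nat.card ι +
          s * (S.card * θ)) := by
  let D : Bichrom σ → Prop := fun p => (p.1.1 ∈ S ∧ σ p.1.2 = l p.1.1) ∨
      (p.1.2 ∈ S ∧ σ p.1.1 = l p.1.2)
  have hmono : ∀ g : ι → Bichrom σ,
      (∀ w ∈ S, (edgeCount (fun t => (g t).1) {w} {u | σ u = l w} : ℝ) < θ) →
      (Nat.card {t // D (g t)} : ℝ) ≤ S.card * θ := by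
    intro g hg
    have h1 : Nat.card {t // D (g t)} ≤
        ∑ w : S, edgeCount (fun t => (g t).1) {w.1} {u | σ u = l w} := by
      refine le_trans (card_mono fun t ht => ?_) (card_exists_le_sum _)
      rcases ht with ⟨h, h'⟩ | ⟨h, h'⟩
      · exact ⟨⟨_, h⟩, Or.inl ⟨rfl, h'⟩⟩
      · exact ⟨⟨_, h⟩, Or.inr ⟨h', rfl⟩⟩
    calc (Nat.card {t // D (g t)} : ℝ)
        ≤ ∑ w : S, (edgeCount (fun t => (g t).1) {w.1} {u | σ u = l w} : ℝ) := by
          exact_mod_cast h1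
      _ ≤ ∑ _w : S, θ := Finset.sum_le_sum fun w _ => (hg _ w.2).le
      _ = _ := by simp
  have hD : 2 * (S.card * a) ≤ Nat.card {p // D p} := card_touching_pairs_ge σ S j hS l hl ha
  calc _ ≤ _ := Nat.cast_le.mpr (card_mono hmono)
    _ ≤ _ := card_few_hits_le D hs
    _ ≤ _ := by
      have h1 : 0 ≤ 1 - Real.exp (-s) := by
        have : Real.exp (-s) ≤ 1 := Real.exp_le_one_iff.mpr (by linarith)
        linarith
      refine mul_le_mul_of_nonneg_left (Real.exp_le_exp.mpr ?_) (by positivity)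
      have : (1 - Real.exp (-s)) * (2 * (S.card * a) / Nat.card (Bichrom σ)) * Nat.card ι ≤
          (1 - Real.exp (-s)) * (Nat.card {p // D p} / Nat.card (Bichrom σ)) * Nat.card ι := by
        gcongr
      linarith

lemma exists_finset_card_eq_of_le {α : Type*} [Finite α] {P : α → Prop} {x : ℕ}
    (h : x ≤ Nat.card {v // P v}) : ∃ S : Finset α, S.card = x ∧ ∀ v ∈ S, P v := by
  classical
  have := Fintype.ofFinite α
  rw [Nat.card_eq_fintype_card, Fintype.card_subtype] at h
  obtain ⟨S, hS, hc⟩ := Finset.exists_subset_card_eq h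
  exact ⟨S, hc, fun v hv => (Finset.mem_filter.mp (hS hv)).2⟩

lemma natCard_finset_card_eq {α : Type*} [Finite α] (x : ℕ) :
    Nat.card {S : Finset α // S.card = x} = (Nat.card α).choose x := by
  have := Fintype.ofFinite α
  rw [Nat.card_eq_fintype_card, Nat.card_eq_fintype_card, Fintype.card_finset_len]

open scoped Classical in
/-- A color class rarely contains `x` vertices with few edges to another class. -/
lemma card_le_weakSet_le {ι V κ : Type*} [Finite ι] [Finite V] [Finite κ] (σ : V → κ) (j : κ)
    (x : ℕ) {a θ s : ℝ} (hs : 0 ≤ s) (ha : ∀ c, a ≤ (Nat.card {v // σ v = c} : ℝ)) :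
    (Nat.card {g : ι → Bichrom σ //
        x ≤ Nat.card {v // v ∈ weakSet σ θ (fun t => (g t).1) j}} : ℝ) ≤
      (Nat.card {v // σ v = j}).choose x * ((Nat.card κ : ℝ) ^ x *
        ((Nat.card (Bichrom σ) : ℝ) ^ Nat.card ι *
        Real.exp (-(1 - Real.exp (-s)) * (2 * (x * a) / Nat.card (Bichrom σ)) * Nat.card ι +
          s * (x * θ)))) := by
  rw [← natCard_finset_card_eq]
  refine le_trans (Nat.cast_le.mpr (card_mono (Q := fun g : ι → Bichrom σ =>
    ∃ S : {S : Finset {v // σ v = j} // S.card = x}, ∃ l : S.1 → κ,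
      ∀ w : S.1, l w ≠ j ∧
      (edgeCount (fun t => (g t).1) {w.1.1} {u | σ u = l w} : ℝ) < θ) fun g hg => ?_)) ?_
  · have h1 : x ≤ Nat.card {v : {v // σ v = j} // v.1 ∈ weakSet σ θ (fun t => (g t).1) j} :=
      hg.trans (Nat.card_le_card_of_injective
        (fun v => ⟨⟨v.1, v.2.1⟩, v.2⟩) fun v w h => by
          simpa [Subtype.ext_iff] using h)
    obtain ⟨S, hS, h⟩ := exists_finset_card_eq_of_le h1
    choose l hl using fun w : S => (h w.1 w.2).2
    exact ⟨⟨S, hS⟩, l, hl⟩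
  · refine card_exists_le _ fun S => ?_
    have hcard : (Nat.card κ : ℝ) ^ x = (Nat.card (S.1 → κ) : ℝ) := by
      rw [Nat.card_fun, Nat.card_eq_fintype_card (α := S.1), Fintype.card_coe, S.2]
      push_cast; rfl
    rw [hcard]
    refine card_exists_le _ fun l => ?_
    by_cases hl : ∀ w : S.1, l w ≠ j
    · have hx : (S.1.map (Function.Embedding.subtype _)).card = x := by
        rw [Finset.card_map, S.2]
      let l' : V → κ := fun v => if h : ∃ hv : σ v = j, (⟨v, hv⟩ : {v // σ v = j}) ∈ S.1 then
        l ⟨_, h.2⟩ else j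
      have hl' : ∀ w : S.1, l' w.1.1 = l w := fun w => by
        have : ∃ hv : σ w.1.1 = j, (⟨w.1.1, hv⟩ : {v // σ v = j}) ∈ S.1 := ⟨w.1.2, w.2⟩
        simp only [l', dif_pos this]
      have := card_weak_of_le (ι := ι) σ (S.1.map (Function.Embedding.subtype _)) j
        (fun w hw => by
          obtain ⟨v, -, rfl⟩ := Finset.mem_map.mp hw
          exact v.2) l'
        (fun w hw => by
          obtain ⟨v, hv, rfl⟩ := Finset.mem_map.mp hw
          exact (hl' ⟨v, hv⟩).trans_ne (hl _)) hs ha (θ := θ)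
      rw [hx] at this
      refine le_trans (Nat.cast_le.mpr (card_mono fun g hg w hw => ?_)) this
      obtain ⟨v, hv, rfl⟩ := Finset.mem_map.mp hw
      have h2 := hl' ⟨v, hv⟩
      simp only [Function.Embedding.subtype_apply] at h2 ⊢
      rw [h2]
      exact (hg ⟨v, hv⟩).2
    · have : IsEmpty {g : ι → Bichrom σ // ∀ w : S.1, l w ≠ j ∧
          (edgeCount (fun t => (g t).1) {w.1.1} {u | σ u = l w} : ℝ) < θ} :=
        ⟨fun g => hl fun w => (g.2 w).1⟩
      rw [Nat.card_of_isEmpty]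
      simp only [Nat.cast_zero]
      positivity

open scoped Classical in
/-- The count of edge sequences in which the edges in `⋃ v, F v` start at the prescribed vertices
and end in the prescribed weak sets. -/
lemma card_prescribed_le {ι V κ : Type*} [Finite ι] [Finite V] (σ : V → κ) (θ : ℝ)
    {u L x : ℕ} {b M : ℝ} (hb : ∀ c, (Nat.card {v // σ v = c} : ℝ) ≤ b)
    (hM : ∀ F : Finset ι, F.card = u * L → (Nat.card {g : {t // t ∉ F} → Bichrom σ //
      ∃ j, x ≤ Nat.card {v // v ∈ weakSet σ θ (fun t => (g t).1) j}} : ℝ) ≤ M)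
    (hM0 : 0 ≤ M) (hb0 : 0 ≤ b)
    (U : Finset V) (hU : U.card = u) (c : U → κ) (F : U → Finset ι) (hF : ∀ v, (F v).card = L) :
    (Nat.card {f : ι → Bichrom σ // ∀ v : U, ∀ t ∈ F v,
      (f t).1.1 = v ∧ (f t).1.2 ∈ weakSet σ θ (fun t => (f t).1) (c v)} : ℝ) ≤
    (Nat.card (Bichrom σ) : ℝ) ^ (Nat.card ι - u * L) * (x : ℝ) ^ (u * L) +
      M * b ^ (u * L) := by
  have := Fintype.ofFinite ι
  by_cases hdisj : ∀ v w : U, v ≠ w → Disjoint (F v) (F w)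
  · let G : Finset ι := Finset.univ.biUnion F
    have hG : G.card = u * L := by
      rw [Finset.card_biUnion fun v _ w _ h => hdisj v w h]
      simp [hF, hU]
    let W : ({t // t ∉ G} → Bichrom σ) → κ → Set V := fun g => weakSet σ θ (fun t => (g t).1)
    let R : ({t // t ∉ G} → Bichrom σ) → ι → Bichrom σ → Prop := fun g t p =>
      ∀ v : U, t ∈ F v → p.1.1 = v ∧ p.1.2 ∈ W g (c v)
    have hR : ∀ g, ∀ t ∈ G, ∃ j, Nat.card {p // R g t p} ≤ Nat.card {v // v ∈ W g j} := by
      intro g t ht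
      obtain ⟨v, -, hv⟩ := Finset.mem_biUnion.mp ht
      refine ⟨c v, Nat.card_le_card_of_injective
        (fun p => ⟨p.1.1.2, (p.2 v hv).2⟩) fun p q h => ?_⟩
      have h2 : p.1.1.2 = q.1.1.2 := congrArg Subtype.val h
      exact Subtype.ext (Subtype.ext
        (Prod.ext ((p.2 v hv).1.trans (q.2 v hv).1.symm) h2))
    have hW : ∀ g j, (Nat.card {v // v ∈ W g j} : ℝ) ≤ b := fun g j =>
      le_trans (Nat.cast_le.mpr (card_mono fun v hv => hv.1)) (hb j)
    have key : ∀ (Q : ({t // t ∉ G} → Bichrom σ) → Prop) (B : ℝ),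
        (∀ g, Q g → ∀ j, (Nat.card {v // v ∈ W g j} : ℝ) ≤ B) →
        (Nat.card {f : ι → Bichrom σ // Q (fun t => f t) ∧ ∀ t ∈ G, R (fun t => f t) t (f t)} : ℝ)
          ≤ Nat.card {g // Q g} * B ^ (u * L) := fun Q B h => by
      rw [← hG]
      refine card_confined_le G Q R fun g hg t ht => ?_
      obtain ⟨j, hj⟩ := hR g t ht
      exact le_trans (Nat.cast_le.mpr hj) (h g hg j)
    let Q : ({t // t ∉ G} → Bichrom σ) → Prop := fun g => ∃ j, x ≤ Nat.card {v // v ∈ W g j}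
    have h1 := key (fun g => ¬ Q g) x fun g hg j => by
      simp only [Q, not_exists, not_le] at hg
      exact_mod_cast (hg j).le
    have h2 := key Q b fun g _ => hW g
    have h3 : Nat.card {g // ¬ Q g} ≤ Nat.card (Bichrom σ) ^ (Nat.card ι - u * L) := by
      refine (Finite.card_subtype_le _).trans ?_
      rw [Nat.card_fun]
      refine (congrArg (Nat.card (Bichrom σ) ^ ·) ?_).le
      rw [← hG]
      simp [Nat.card_eq_fintype_card, Fintype.card_subtype_compl]
    have h4 : (Nat.card {g // Q g} : ℝ) ≤ M := hM G hG
    let P₁ : (ι → Bichrom σ) → Prop := fun f =>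
      ¬ Q (fun t => f t) ∧ ∀ t ∈ G, R (fun t => f t) t (f t)
    let P₂ : (ι → Bichrom σ) → Prop := fun f =>
      Q (fun t => f t) ∧ ∀ t ∈ G, R (fun t => f t) t (f t)
    have h5 : ∀ f : ι → Bichrom σ, (∀ v : U, ∀ t ∈ F v,
        (f t).1.1 = v ∧ (f t).1.2 ∈ weakSet σ θ (fun t => (f t).1) (c v)) → P₁ f ∨ P₂ f := by
      intro f hf
      have : ∀ t ∈ G, R (fun t => f t) t (f t) := fun t _ v hv =>
        ⟨(hf v t hv).1, weakSet_subset_comp σ θ (fun t => (f t).1) _ Subtype.val_injective _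
          (hf v t hv).2⟩
      by_cases hQ : Q (fun t => f t)
      · exact Or.inr ⟨hQ, this⟩
      · exact Or.inl ⟨hQ, this⟩
    refine le_trans (Nat.cast_le.mpr ((card_mono h5).trans (card_or_le P₁ P₂))) ?_
    rw [Nat.cast_add]
    refine add_le_add (h1.trans ?_) (h2.trans ?_)
    · gcongr
      exact_mod_cast h3
    · gcongr
  · have : IsEmpty {f : ι → Bichrom σ // ∀ v : U, ∀ t ∈ F v,
        (f t).1.1 = v ∧ (f t).1.2 ∈ weakSet σ θ (fun t => (f t).1) (c v)} := by
      refine ⟨fun f => hdisj fun v w hvw => Finset.disjoint_left.mpr fun t hv hw => hvw ?_⟩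
      exact Subtype.ext ((f.2 v t hv).1.symm.trans (f.2 w t hw).1)
    rw [Nat.card_of_isEmpty]
    simp only [Nat.cast_zero]
    positivity

open scoped Classical in
/-- Few edge sequences have `u` vertices with `L` outgoing edges into a single weak set. -/
lemma card_heavy_le {ι V κ : Type*} [Finite ι] [Finite V] [Finite κ] (σ : V → κ) (θ : ℝ)
    {u L x : ℕ} {b M : ℝ} (hb : ∀ c, (Nat.card {v // σ v = c} : ℝ) ≤ b)
    (hM : ∀ F : Finset ι, F.card = u * L → (Nat.card {g : {t // t ∉ F} → Bichrom σ //
      ∃ j, x ≤ Nat.card {v // v ∈ weakSet σ θ (fun t => (g t).1) j}} : ℝ) ≤ M)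
    (hM0 : 0 ≤ M) (hb0 : 0 ≤ b) :
    (Nat.card {f : ι → Bichrom σ // u ≤ Nat.card {v // ∃ j, L ≤ Nat.card {t //
        (f t).1.1 = v ∧ (f t).1.2 ∈ weakSet σ θ (fun t => (f t).1) j}}} : ℝ) ≤
      (Nat.card V).choose u * ((Nat.card κ * (Nat.card ι).choose L : ℝ) ^ u *
        ((Nat.card (Bichrom σ) : ℝ) ^ (Nat.card ι - u * L) * (x : ℝ) ^ (u * L) +
          M * b ^ (u * L))) := by
  rw [← natCard_finset_card_eq, ← natCard_finset_card_eq]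
  refine le_trans (Nat.cast_le.mpr (card_mono (Q := fun f : ι → Bichrom σ =>
    ∃ U : {U : Finset V // U.card = u}, ∃ c : U.1 → κ × {F : Finset ι // F.card = L},
      ∀ v : U.1, ∀ t ∈ (c v).2.1,
        (f t).1.1 = v ∧ (f t).1.2 ∈ weakSet σ θ (fun t => (f t).1) (c v).1) fun f hf => ?_)) ?_
  · obtain ⟨U, hU, h⟩ := exists_finset_card_eq_of_le hf
    choose j hj using fun v : U => h v v.2
    choose F hF hF' using fun v : U => exists_finset_card_eq_of_le (hj v)
    exact ⟨⟨U, hU⟩, fun v => (j v, ⟨F v, hF v⟩), hF'⟩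
  · refine card_exists_le _ fun U => ?_
    have hcard : (Nat.card κ * Nat.card {F : Finset ι // F.card = L} : ℝ) ^ u =
        (Nat.card (U.1 → κ × {F : Finset ι // F.card = L}) : ℝ) := by
      rw [Nat.card_fun, Nat.card_prod, Nat.card_eq_fintype_card (α := U.1), Fintype.card_coe, U.2]
      push_cast; rfl
    rw [hcard]
    exact card_exists_le _ fun c => card_prescribed_le σ θ hb hM hM0 hb0 U.1 U.2
      (fun v => (c v).1) (fun v => (c v).2.1) fun v => (c v).2.2

lemma edgeCount_swap {ι V : Type*} (e : ι → V × V) (A B : Set V) :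
    edgeCount (fun t => (e t).swap) A B = edgeCount e A B := by
  refine congrArg (fun P : ι → Prop => Nat.card {t // P t}) (funext fun t => propext ?_)
  simp only [Prod.fst_swap, Prod.snd_swap]
  tauto

lemma weakSet_swap {ι V κ : Type*} (σ : V → κ) (θ : ℝ) (e : ι → V × V) :
    weakSet σ θ (fun t => (e t).swap) = weakSet σ θ e := by
  unfold weakSet
  simp_rw [edgeCount_swap]

/-- The reversal of all edges of a sequence of bichromatic pairs. -/
def reverseEquiv {ι V κ : Type*} (σ : V → κ) : (ι → Bichrom σ) ≃ (ι → Bichrom σ) where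
  toFun f t := ⟨(f t).1.swap, (f t).2.symm⟩
  invFun f t := ⟨(f t).1.swap, (f t).2.symm⟩
  left_inv _ := rfl
  right_inv _ := rfl

/-- `u` vertices each have `L` outgoing edges into a single weak set. -/
def Heavy {ι V κ : Type*} (σ : V → κ) (θ : ℝ) (u L : ℕ) (f : ι → Bichrom σ) : Prop :=
  u ≤ Nat.card {v // ∃ j, L ≤ Nat.card {t //
    (f t).1.1 = v ∧ (f t).1.2 ∈ weakSet σ θ (fun t => (f t).1) j}}

lemma heavy_or_heavy_reverse {ι V κ : Type*} [Finite ι] [Finite V] (σ : V → κ)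
    {θ y q : ℝ} (f : ι → Bichrom σ)
    (h : y < Nat.card {v // ∃ j,
      q < (edgeCount (fun t => (f t).1) {v} (weakSet σ θ (fun t => (f t).1) j) : ℝ)}) :
    Heavy σ θ ⌈y / 2⌉₊ ⌈q / 2⌉₊ f ∨ Heavy σ θ ⌈y / 2⌉₊ ⌈q / 2⌉₊ (reverseEquiv σ f) := by
  let H : (ι → Bichrom σ) → V → Prop := fun f v => ∃ j, ⌈q / 2⌉₊ ≤ Nat.card {t //
    (f t).1.1 = v ∧ (f t).1.2 ∈ weakSet σ θ (fun t => (f t).1) j}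
  have h1 : ∀ v, (∃ j,
      q < (edgeCount (fun t => (f t).1) {v} (weakSet σ θ (fun t => (f t).1) j) : ℝ)) →
      H f v ∨ H (reverseEquiv σ f) v := by
    rintro v ⟨j, hj⟩
    have hsum : (edgeCount (fun t => (f t).1) {v} (weakSet σ θ (fun t => (f t).1) j) : ℝ) ≤
        Nat.card {t // (f t).1.1 = v ∧ (f t).1.2 ∈ weakSet σ θ (fun t => (f t).1) j} +
        Nat.card {t // (f t).1.2 = v ∧ (f t).1.1 ∈ weakSet σ θ (fun t => (f t).1) j} := by
      exact_mod_cast (card_mono fun t ht => by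
        rcases ht with ⟨ht, ht'⟩ | ⟨ht, ht'⟩
        · exact Or.inl ⟨ht, ht'⟩
        · exact Or.inr ⟨ht', ht⟩).trans (card_or_le _ _)
    rcases le_total (q / 2) (Nat.card {t // (f t).1.1 = v ∧
        (f t).1.2 ∈ weakSet σ θ (fun t => (f t).1) j} : ℝ) with hc | hc
    · exact Or.inl ⟨j, Nat.ceil_le.mpr hc⟩
    · refine Or.inr ⟨j, ?_⟩
      have : weakSet σ θ (fun t => (reverseEquiv σ f t).1) = weakSet σ θ (fun t => (f t).1) :=
        weakSet_swap σ θ fun t => (f t).1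
      rw [this]
      exact Nat.ceil_le.mpr (by
        change q / 2 ≤ (Nat.card {t // (f t).1.2 = v ∧
          (f t).1.1 ∈ weakSet σ θ (fun t => (f t).1) j} : ℝ)
        linarith)
  have h2 : (Nat.card {v // ∃ j,
      q < (edgeCount (fun t => (f t).1) {v} (weakSet σ θ (fun t => (f t).1) j) : ℝ)} : ℝ) ≤
      Nat.card {v // H f v} + Nat.card {v // H (reverseEquiv σ f) v} := by
    exact_mod_cast (card_mono h1).trans (card_or_le _ _)
  rcases le_total (y / 2) (Nat.card {v // H f v} : ℝ) with hc | hc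
  · exact Or.inl (Nat.ceil_le.mpr hc)
  · exact Or.inr (Nat.ceil_le.mpr (show y / 2 ≤ (Nat.card {v // H (reverseEquiv σ f) v} : ℝ) by
      linarith))

lemma prob_le_card_heavy {n m k : ℕ} (σ : Fin n → Fin k) (y : ℝ) :
    prob (fun e : CondSpace n m k σ => y < (Nat.card {v : Fin n // ∃ j : Fin k,
      ell k < (eSet e.1 {v} (Wset σ e.1 j) : ℝ)} : ℝ)) ≤
    2 * (Nat.card {f : Fin m → Bichrom σ // Heavy σ (3 * ell k) ⌈y / 2⌉₊ ⌈ell k / 2⌉₊ f} : ℝ) /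
      (Nat.card (Bichrom σ) : ℝ) ^ m := by
  let φ : CondSpace n m k σ ≃ (Fin m → Bichrom σ) :=
    { toFun := fun e t => ⟨e.1 t, e.2 t⟩
      invFun := fun f => ⟨fun t => (f t).1, fun t => (f t).2⟩
      left_inv := fun _ => rfl
      right_inv := fun _ => rfl }
  have hcard : Nat.card (CondSpace n m k σ) = Nat.card (Bichrom σ) ^ m := by
    rw [Nat.card_congr φ, Nat.card_fun, Nat.card_fin]
  unfold prob
  rw [hcard]
  push_cast
  refine div_le_div_of_nonneg_right ?_ (by positivity)
  let P : (Fin m → Bichrom σ) → Prop := Heavy σ (3 * ell k) ⌈y / 2⌉₊ ⌈ell k / 2⌉₊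
  have h1 : Nat.card {e : CondSpace n m k σ // y < (Nat.card {v : Fin n // ∃ j : Fin k,
      ell k < (eSet e.1 {v} (Wset σ e.1 j) : ℝ)} : ℝ)} ≤
      Nat.card {e : CondSpace n m k σ // P (φ e) ∨ P (reverseEquiv σ (φ e))} :=
    card_mono fun e he => heavy_or_heavy_reverse σ (φ e) he
  have h2 := h1.trans (card_or_le _ _)
  rw [Nat.card_congr (φ.subtypeEquiv (p := fun e => P (φ e)) (q := P) fun _ => Iff.rfl),
    Nat.card_congr ((φ.trans (reverseEquiv σ)).subtypeEquiv
      (p := fun e => P (reverseEquiv σ (φ e))) (q := P) fun _ => Iff.rfl)] at h2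
  rw [two_mul]
  exact_mod_cast h2

lemma choose_le_exp_mul_div_pow (n r : ℕ) :
    (n.choose r : ℝ) ≤ (Real.exp 1 * n / r) ^ r := by
  rcases Nat.eq_zero_or_pos r with rfl | hr
  · simp
  have h1 : (n.choose r : ℝ) ≤ (n : ℝ) ^ r / r.factorial := Nat.choose_le_pow_div r n
  have h2 : (r : ℝ) ^ r / r.factorial ≤ Real.exp r := Real.pow_div_factorial_le_exp _ (by positivity) r
  have hr' : (0 : ℝ) < r := by exact_mod_cast hr
  have hf : (0 : ℝ) < r.factorial := by exact_mod_cast r.factorial_pos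
  refine h1.trans ?_
  rw [div_pow, mul_pow, ← Real.exp_nat_mul, mul_one]
  rw [div_le_iff₀ hf] at h2 ⊢
  have h3 : (n : ℝ) ^ r * (r : ℝ) ^ r ≤ (n : ℝ) ^ r * (Real.exp r * r.factorial) := by gcongr
  rw [div_mul_eq_mul_div, le_div_iff₀ (by positivity)]
  linarith

lemma card_heavy_le_of_class_bounds {ι V κ : Type*} [Finite ι] [Finite V] [Finite κ] (σ : V → κ)
    {θ s a b : ℝ} {u L x : ℕ} (hs : 0 ≤ s) (hb0 : 0 ≤ b)
    (ha : ∀ c, a ≤ (Nat.card {v // σ v = c} : ℝ)) (hb : ∀ c, (Nat.card {v // σ v = c} : ℝ) ≤ b)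
    (hm : u * L ≤ Nat.card ι) (hN : 0 < Nat.card (Bichrom σ)) :
    (Nat.card {f : ι → Bichrom σ // Heavy σ θ u L f} : ℝ) / (Nat.card (Bichrom σ)) ^ Nat.card ι ≤
      (Real.exp 1 * Nat.card V * Nat.card κ / u) ^ u *
        ((Real.exp 1 * Nat.card ι * x / (L * Nat.card (Bichrom σ))) ^ (u * L) +
        (Real.exp 1 * Nat.card ι * b / (L * Nat.card (Bichrom σ))) ^ (u * L) * (Nat.card κ *
          ((Real.exp 1 * b * Nat.card κ / x) ^ x *
            Real.exp (-(1 - Real.exp (-s)) * (2 * (x * a) / Nat.card (Bichrom σ)) *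
              (Nat.card ι - u * L) + s * (x * θ))))) := by
  have := Fintype.ofFinite ι
  set N : ℝ := (Nat.card (Bichrom σ) : ℝ) with hNdef
  have hN' : 0 < N := by rw [hNdef]; exact_mod_cast hN
  set X : ℝ := Real.exp (-(1 - Real.exp (-s)) * (2 * (x * a) / N) *
              (Nat.card ι - u * L) + s * (x * θ)) with hX
  set M : ℝ := Nat.card κ * ((Real.exp 1 * b * Nat.card κ / x) ^ x *
    (N ^ (Nat.card ι - u * L) * X)) with hMdef
  have hM0 : 0 ≤ M := by positivity
  have hM : ∀ F : Finset ι, F.card = u * L → (Nat.card {g : {t // t ∉ F} → Bichrom σ //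
      ∃ j, x ≤ Nat.card {v // v ∈ weakSet σ θ (fun t => (g t).1) j}} : ℝ) ≤ M := by
    intro F hF
    have hc : Nat.card {t // t ∉ F} = Nat.card ι - u * L := by
      classical
      rw [← hF]
      simp [Nat.card_eq_fintype_card, Fintype.card_subtype_compl]
    refine card_exists_le _ fun j => (card_le_weakSet_le σ j x hs ha).trans ?_
    rw [hc, ← hNdef, Nat.cast_sub hm]
    push_cast
    rw [← hX]
    calc _ ≤ (Real.exp 1 * b / x) ^ x * ((Nat.card κ : ℝ) ^ x *
          (N ^ (Nat.card ι - u * L) * X)) := by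
          refine mul_le_mul_of_nonneg_right ((choose_le_exp_mul_div_pow _ _).trans ?_)
            (by positivity)
          gcongr
          exact hb j
      _ = _ := by rw [mul_div_right_comm _ _ (x : ℝ), mul_pow]; ring
  have h := card_heavy_le σ θ (u := u) (L := L) hb hM hM0 hb0
  rw [div_le_iff₀ (by positivity)]
  refine h.trans ?_
  have hpow : N ^ Nat.card ι = N ^ (Nat.card ι - u * L) * N ^ (u * L) := by
    rw [← pow_add, Nat.sub_add_cancel hm]
  calc _ ≤ (Real.exp 1 * Nat.card V / u) ^ u *
        ((Nat.card κ * (Real.exp 1 * Nat.card ι / L) ^ L : ℝ) ^ u *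
        (N ^ (Nat.card ι - u * L) * (x : ℝ) ^ (u * L) + M * b ^ (u * L))) := by
        gcongr
        · exact choose_le_exp_mul_div_pow _ _
        · exact choose_le_exp_mul_div_pow _ _
    _ = _ := by
      have e1 : (Nat.card κ * (Real.exp 1 * Nat.card ι / L) ^ L : ℝ) ^ u =
          (Nat.card κ : ℝ) ^ u * (Real.exp 1 * Nat.card ι / L) ^ (u * L) := by
        rw [mul_pow, ← pow_mul, mul_comm L u]
      have e2 : ∀ z : ℝ, (Real.exp 1 * Nat.card ι * z / (L * N)) ^ (u * L) * N ^ (u * L) =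
          (Real.exp 1 * Nat.card ι / L) ^ (u * L) * z ^ (u * L) := by
        intro z
        rw [← mul_pow, ← mul_pow]
        congr 1
        rw [div_mul_eq_mul_div, mul_div_mul_right _ _ hN'.ne']
        ring
      have e3 : (Real.exp 1 * Nat.card V * Nat.card κ / u) ^ u =
          (Real.exp 1 * Nat.card V / u) ^ u * (Nat.card κ : ℝ) ^ u := by
        rw [← mul_pow]; congr 1; ring
      rw [e1, e3, hpow, hMdef]
      linear_combination (-(Real.exp 1 * Nat.card V / u) ^ u * (Nat.card κ : ℝ) ^ u *
        N ^ (Nat.card ι - u * L)) * e2 x - ((Real.exp 1 * Nat.card V / u) ^ u *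
        (Nat.card κ : ℝ) ^ u * N ^ (Nat.card ι - u * L) * (Nat.card κ *
          ((Real.exp 1 * b * Nat.card κ / x) ^ x * X))) * e2 b

lemma pow_le_exp_of_le {z c d : ℝ} {r : ℕ} (hz : 0 ≤ z) (h : z ≤ Real.exp c) (hd : r * c ≤ d) :
    z ^ r ≤ Real.exp d := by
  calc z ^ r ≤ Real.exp c ^ r := pow_le_pow_left₀ hz h r
    _ = Real.exp (r * c) := (Real.exp_nat_mul _ _).symm
    _ ≤ _ := Real.exp_le_exp.mpr hd

lemma exp_neg_seven_le : Real.exp (-7) ≤ 1 / 128 := by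
  rw [Real.exp_neg, one_div]
  refine inv_anti₀ (by norm_num) ?_
  have h := Real.exp_one_gt_d9
  calc (128 : ℝ) = 2 ^ 7 := by norm_num
    _ ≤ Real.exp 1 ^ 7 := by gcongr; linarith
    _ = Real.exp 7 := by rw [← Real.exp_nat_mul]; norm_num

lemma exp_neg_two_le : Real.exp (-2) ≤ 1 / 4 := by
  rw [Real.exp_neg, one_div]
  refine inv_anti₀ (by norm_num) ?_
  have h := Real.exp_one_gt_d9
  calc (4 : ℝ) = 2 ^ 2 := by norm_num
    _ ≤ Real.exp 1 ^ 2 := by gcongr; linarith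
    _ = Real.exp 2 := by rw [← Real.exp_nat_mul]; norm_num

lemma sixteen_exp_eight_le : 16 * Real.exp 8 ≤ Real.exp 11 := by
  have h := Real.exp_one_gt_d9
  have h3 : (16 : ℝ) ≤ Real.exp 3 := by
    calc (16 : ℝ) ≤ 2.7 ^ 3 := by norm_num
      _ ≤ Real.exp 1 ^ 3 := by gcongr; linarith
      _ = Real.exp 3 := by rw [← Real.exp_nat_mul]; norm_num
  calc 16 * Real.exp 8 ≤ Real.exp 3 * Real.exp 8 := by gcongr
    _ = Real.exp 11 := by rw [← Real.exp_add]; norm_num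

lemma choice_factor_le {n k l h T : ℝ} {u : ℕ} (hn : 0 < n) (hTpos : 0 < T)
    (hkl : Real.exp l = k) (hh : 1 ≤ h) (hlk : 6 * l ≤ k) (hT : T * (k * l) = n * h)
    (hu : T / 2 ≤ u) :
    (Real.exp 1 * n * k / u) ^ u ≤ Real.exp (3 * (u * l)) := by
  have hk0 : 0 < k := hkl ▸ Real.exp_pos l
  have hu0 : (0 : ℝ) < u := by linarith
  have he3 : Real.exp 1 < 3 := by linarith [Real.exp_one_lt_d9]
  refine pow_le_exp_of_le (c := 3 * l) (by positivity) ?_ (by linarith)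
  have : Real.exp (3 * l) = k ^ 3 := by
    rw [← hkl, ← Real.exp_nat_mul]; norm_num
  rw [this, div_le_iff₀ hu0]
  have h1 : n ≤ T * (k * l) := hT ▸ le_mul_of_one_le_right hn.le hh
  calc Real.exp 1 * n * k ≤ 3 * (T * (k * l)) * k := by gcongr
    _ = k ^ 2 * (6 * l) * (T / 2) := by ring
    _ ≤ k ^ 2 * k * u := by gcongr
    _ = k ^ 3 * u := by ring

lemma exp_neg_seven_mul_exp_eight : Real.exp (-7) * Real.exp 8 = Real.exp 1 := by
  rw [← Real.exp_add]; norm_num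

lemma sparse_factor_le {n k l h T m D : ℝ} {u L x : ℕ} (hk : 0 < k) (hl : 0 < l) (hn : 0 < n)
    (hh : 0 ≤ h) (hβ : 168 * Real.exp 8 * h / l ≤ Real.exp (-(10 * Real.exp 7)))
    (hT : T * (k * l) = n * h) (hL : Real.exp (-7) * l / 2 ≤ L) (hx' : x ≤ 21 * T)
    (hm0 : 0 ≤ m) (hm' : m ≤ 2 * (n * k * l)) (hD : Real.exp (-7) * l * n ^ 2 / 4 ≤ D) :
    (Real.exp 1 * m * x / D) ^ (u * L) ≤ Real.exp (-(5 * (u * l))) := by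
  have hD0 : 0 < D := lt_of_lt_of_le (by positivity) hD
  refine pow_le_exp_of_le (c := -(10 * Real.exp 7)) (by positivity) (le_trans ?_ hβ) ?_
  · rw [div_le_iff₀ hD0]
    calc Real.exp 1 * m * x ≤ Real.exp 1 * (2 * (n * k * l)) * (21 * T) := by gcongr
      _ = 42 * Real.exp 1 * n * (T * (k * l)) := by ring
      _ = 168 * (Real.exp (-7) * Real.exp 8) * h / l * (l * n ^ 2 / 4) := by
        rw [hT, exp_neg_seven_mul_exp_eight]; field_simp; ring
      _ = 168 * Real.exp 8 * h / l * (Real.exp (-7) * l * n ^ 2 / 4) := by ring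
      _ ≤ _ := by gcongr
  · push_cast
    have : Real.exp 7 * Real.exp (-7) = 1 := by rw [← Real.exp_add]; norm_num
    have h2 : u * (Real.exp (-7) * l / 2) * (10 * Real.exp 7) ≤ u * L * (10 * Real.exp 7) := by
      gcongr
    have h3 : u * (Real.exp (-7) * l / 2) * (10 * Real.exp 7) =
      5 * (u * l) * (Real.exp 7 * Real.exp (-7)) := by ring
    rw [h3, this] at h2
    linarith

lemma dense_factor_le {n k l m D : ℝ} {u L : ℕ} (hk : 0 < k) (hl : 0 < l) (hn : 0 < n)
    (huL : (u : ℝ) * L ≤ u * l / 128)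
    (hm0 : 0 ≤ m) (hm' : m ≤ 2 * (n * k * l)) (hD : Real.exp (-7) * l * n ^ 2 / 4 ≤ D) :
    (Real.exp 1 * m * (2 * n / k) / D) ^ (u * L) ≤ Real.exp (u * l) := by
  have hD0 : 0 < D := lt_of_lt_of_le (by positivity) hD
  refine pow_le_exp_of_le (c := 11) (by positivity) (le_trans ?_ sixteen_exp_eight_le) ?_
  · rw [div_le_iff₀ hD0]
    calc Real.exp 1 * m * (2 * n / k) ≤ Real.exp 1 * (2 * (n * k * l)) * (2 * n / k) := by gcongr
      _ = 16 * (Real.exp (-7) * Real.exp 8) * (l * n ^ 2 / 4) := by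
        rw [exp_neg_seven_mul_exp_eight]; field_simp; norm_num
      _ = 16 * Real.exp 8 * (Real.exp (-7) * l * n ^ 2 / 4) := by ring
      _ ≤ _ := by gcongr
  · push_cast
    have : 0 ≤ u * l := by positivity
    linarith

lemma weak_choice_factor_le {n k l h T : ℝ} {x : ℕ} (hn : 0 < n) (hl : 0 < l) (hTpos : 0 < T)
    (hkl : Real.exp l = k) (hlh : Real.exp h = l) (hh : 1 ≤ h) (hhl : h ≤ 0.05 * l)
    (hT : T * (k * l) = n * h) (hx : 20 * T ≤ x) :
    (Real.exp 1 * (2 * n / k) * k / x) ^ x ≤ Real.exp (1.05 * (x * l)) := by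
  have hk0 : 0 < k := hkl ▸ Real.exp_pos l
  have hx0 : (0 : ℝ) < x := by linarith
  have he3 : Real.exp 1 < 3 := by linarith [Real.exp_one_lt_d9]
  refine pow_le_exp_of_le (c := 1.05 * l) (by positivity) ?_ (by linarith)
  have hkl' : k * l ≤ Real.exp (1.05 * l) := by
    calc k * l = Real.exp (l + h) := by rw [Real.exp_add, hkl, hlh]
      _ ≤ _ := Real.exp_le_exp.mpr (by linarith)
  refine le_trans ?_ hkl'
  rw [div_le_iff₀ hx0]
  have h1 : n ≤ T * (k * l) := hT ▸ le_mul_of_one_le_right hn.le hh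
  have h2 : 0 < T * (k * l) := by positivity
  calc Real.exp 1 * (2 * n / k) * k = Real.exp 1 * 2 * n := by field_simp
    _ ≤ 3 * 2 * (T * (k * l)) := by gcongr
    _ ≤ k * l * (20 * T) := by linarith
    _ ≤ _ := by gcongr

lemma weak_exponent_le {n k l m N f : ℝ} {x : ℕ} (hn : 0 < n) (hk : 0 < k) (hl : 0 < l)
    (hfm : 0.97 * (n * k * l) ≤ m - f) (hN : 0 < N) (hN' : N ≤ n ^ 2) :
    -(1 - Real.exp (-2)) * (2 * (x * (0.95 * n / k)) / N) *
      (m - f) + 2 * (x * (3 * (Real.exp (-7) * l))) ≤ -1.33 * (x * l) := by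
  have hp : 2 * (x * (0.95 * n / k)) / n ^ 2 ≤ 2 * (x * (0.95 * n / k)) / N := by
    gcongr
  have he2 : 3 / 4 ≤ 1 - Real.exp (-2) := by linarith [exp_neg_two_le]
  have h1 : 3 / 4 * (2 * (x * (0.95 * n / k)) / n ^ 2) * (0.97 * (n * k * l)) ≤
      (1 - Real.exp (-2)) * (2 * (x * (0.95 * n / k)) / N) * (m - f) := by
    gcongr
  have h2 : 3 / 4 * (2 * (x * (0.95 * n / k)) / n ^ 2) * (0.97 * (n * k * l)) =
      1.38225 * (x * l) := by
    field_simp; ring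
  have h3 : (x : ℝ) * (Real.exp (-7) * l) ≤ x * (1 / 128 * l) := by
    gcongr; exact exp_neg_seven_le
  have : 0 ≤ x * l := by positivity
  linarith

/-- `l` and `h` stand for `log k` and `log (log k)`, and `T` for the threshold `n * h / (k * l)`. -/
lemma heavy_bound_numeric {n k l h T m N : ℝ} {u L x : ℕ} (hn : 0 < n) (hk : 1000 ≤ k)
    (hkl : Real.exp l = k) (hlh : Real.exp h = l) (hh : 20 ≤ h) (hhl : h ≤ 0.05 * l)
    (hlk : 6 * l ≤ k) (hβ : 168 * Real.exp 8 * h / l ≤ Real.exp (-(10 * Real.exp 7)))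
    (hT : T * (k * l) = n * h) (hu : T / 2 ≤ u) (hu' : u ≤ T)
    (hL : Real.exp (-7) * l / 2 ≤ L) (hL' : L ≤ Real.exp (-7) * l)
    (hx : 20 * T ≤ x) (hx' : x ≤ 21 * T)
    (hm : 0.98 * (n * k * l) ≤ m) (hm' : m ≤ 2 * (n * k * l)) (hN : n ^ 2 / 2 ≤ N)
    (hN' : N ≤ n ^ 2) :
    (Real.exp 1 * n * k / u) ^ u *
        ((Real.exp 1 * m * x / (L * N)) ^ (u * L) +
        (Real.exp 1 * m * (2 * n / k) / (L * N)) ^ (u * L) * (k *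
          ((Real.exp 1 * (2 * n / k) * k / x) ^ x *
            Real.exp (-(1 - Real.exp (-2)) * (2 * (x * (0.95 * n / k)) / N) *
              (m - u * L) + 2 * (x * (3 * (Real.exp (-7) * l))))))) ≤
      (1 + k) * Real.exp (-(16 * n / k)) := by
  have hk0 : 0 < k := by linarith
  have hl : 400 ≤ l := by linarith
  have hl0 : 0 < l := by linarith
  have hTpos : 0 < T := by
    have : 0 < T * (k * l) := hT ▸ by positivity
    exact (pos_iff_pos_of_mul_pos this).2 (by positivity)
  have hu0 : (0 : ℝ) < u := by linarith
  have hx0 : (0 : ℝ) < x := by linarith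
  have hq0 : 0 < Real.exp (-7) * l := by positivity
  have hL0 : (0 : ℝ) < L := by linarith
  have hN0 : 0 < N := by have : 0 < n ^ 2 := by positivity
                         linarith
  have hm0 : 0 < m := by have : 0 < n * k * l := by positivity
                         linarith
  have he7 : Real.exp (-7) * l ≤ l / 128 := by
    linarith [mul_le_mul_of_nonneg_right exp_neg_seven_le hl0.le]
  have huL : (u : ℝ) * L ≤ u * l / 128 := by
    rw [mul_div_assoc]
    exact mul_le_mul_of_nonneg_left (hL'.trans he7) hu0.le
  have hul : n / k * 10 ≤ u * l := by
    have : n / k * 10 = (T / 2) * l * (20 / h) := by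
      have : n = T * (k * l) / h := by field_simp; linarith
      rw [this]; field_simp; norm_num
    rw [this]
    have h20 : 20 / h ≤ 1 := by rw [div_le_one (by linarith)]; exact hh
    calc T / 2 * l * (20 / h) ≤ T / 2 * l * 1 := by gcongr
      _ ≤ u * l := by rw [mul_one]; gcongr
  have hLN : Real.exp (-7) * l * n ^ 2 / 4 ≤ L * N := by
    calc _ = Real.exp (-7) * l / 2 * (n ^ 2 / 2) := by ring
      _ ≤ _ := by gcongr
  have hfm : 0.97 * (n * k * l) ≤ m - u * L := by
    have h2 : (u : ℝ) ≤ n * k := by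
      have h3 : T * 1 ≤ T * (k * l) := 
        mul_le_mul_of_nonneg_left (one_le_mul_of_one_le_of_one_le (by linarith) (by linarith)) hTpos.le
      have h4 : n * h ≤ n * k := mul_le_mul_of_nonneg_left (by linarith) hn.le
      linarith
    have : u * l ≤ n * k * l := by gcongr
    linarith
  have B1 := choice_factor_le hn hTpos hkl (by linarith) hlk hT hu
  have B2 := sparse_factor_le (u := u) hk0 hl0 hn (by linarith) hβ hT hL hx' hm0.le hm' hLN
  have B3 := dense_factor_le hk0 hl0 hn huL hm0.le hm' hLN
  have B4 := weak_choice_factor_le hn hl0 hTpos hkl hlh (by linarith) hhl hT hx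
  have B5 := weak_exponent_le (x := x) hn hk0 hl0 hfm hN0 hN'
  have hxul : 20 * (u * l) ≤ x * l := by
    linarith [mul_le_mul_of_nonneg_right (show 20 * (u : ℝ) ≤ x by linarith) hl0.le]
  calc _ ≤ Real.exp (3 * (u * l)) * (Real.exp (-(5 * (u * l))) +
        Real.exp (u * l) * (k * (Real.exp (1.05 * (x * l)) * Real.exp (-1.33 * (x * l))))) := by
        gcongr
    _ = Real.exp (-2 * (u * l)) + k * Real.exp (4 * (u * l) - 0.28 * (x * l)) := by
        rw [mul_add, ← Real.exp_add, ← Real.exp_add]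
        have : Real.exp (4 * (u * l) - 0.28 * (x * l)) = Real.exp (3 * (u * l)) *
            Real.exp (u * l) * Real.exp (1.05 * (x * l) + -1.33 * (x * l)) := by
          rw [← Real.exp_add, ← Real.exp_add]; ring_nf
        rw [this]
        ring_nf
    _ ≤ Real.exp (-(16 * n / k)) + k * Real.exp (-(16 * n / k)) := by
        have : 16 * n / k = n / k * 10 * 1.6 := by ring
        have hnk : 0 < n / k := by positivity
        gcongr
        · linarith
        · linarith
    _ = _ := by ring

lemma card_bichrom_le {V κ : Type*} [Finite V] (σ : V → κ) :
    (Nat.card (Bichrom σ) : ℝ) ≤ (Nat.card V : ℝ) ^ 2 := by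
  have h := Finite.card_subtype_le fun p : V × V => σ p.1 ≠ σ p.2
  rw [Nat.card_prod, ← sq] at h
  exact_mod_cast h

lemma le_card_bichrom {V κ : Type*} [Finite V] (σ : V → κ)
    (h : ∀ c, (Nat.card {v // σ v = c} : ℝ) ≤ Nat.card V / 2) :
    (Nat.card V : ℝ) ^ 2 / 2 ≤ Nat.card (Bichrom σ) := by
  have := Fintype.ofFinite V
  have h1 : Nat.card (Σ v : V, {w // ¬ σ w = σ v}) ≤ Nat.card (Bichrom σ) :=
    Nat.card_le_card_of_injective (fun z => ⟨(z.1, z.2.1), fun h => z.2.2 h.symm⟩) (by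
      rintro ⟨v, w, hw⟩ ⟨v', w', hw'⟩ h
      simp only [Subtype.mk.injEq, Prod.mk.injEq] at h
      obtain ⟨rfl, rfl⟩ := h
      rfl)
  rw [Nat.card_sigma] at h1
  have h2 : ∀ v : V, (Nat.card V : ℝ) / 2 ≤ Nat.card {w // ¬ σ w = σ v} := fun v => by
    have h3 : Nat.card V ≤ Nat.card {w // σ w = σ v} + Nat.card {w // ¬ σ w = σ v} := by
      refine le_trans ?_ (card_or_le _ _)
      simp [em]
    have h4 : (Nat.card V : ℝ) ≤ Nat.card {w // σ w = σ v} + Nat.card {w // ¬ σ w = σ v} := by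
      exact_mod_cast h3
    linarith [h (σ v)]
  calc (Nat.card V : ℝ) ^ 2 / 2 = ∑ _v : V, (Nat.card V : ℝ) / 2 := by
        simp [Nat.card_eq_fintype_card]; ring
    _ ≤ ∑ v : V, (Nat.card {w // ¬ σ w = σ v} : ℝ) := Finset.sum_le_sum fun v _ => h2 v
    _ ≤ _ := by exact_mod_cast h1

/-- The properties of large `k` that the estimates use. -/
lemma eventually_large_log : ∀ᶠ k : ℕ in Filter.atTop,
    1000 ≤ (k : ℝ) ∧ 20 ≤ Real.log (Real.log k) ∧
    Real.log (Real.log k) ≤ 0.05 * Real.log k ∧ 6 * Real.log k ≤ k ∧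
    168 * Real.exp 8 * Real.log (Real.log k) / Real.log k ≤ Real.exp (-(10 * Real.exp 7)) ∧
    2 ≤ Real.exp (-7) * Real.log k ∧ 20 ≤ Real.log k ^ ((1 : ℝ) / 3) := by
  have hk := tendsto_natCast_atTop_atTop (R := ℝ)
  have hl := Real.tendsto_log_atTop.comp hk
  have hh := Real.tendsto_log_atTop.comp hl
  have hr := (tendsto_rpow_atTop (show (0 : ℝ) < 1 / 3 by norm_num)).comp hl
  have hlog : ∀ c : ℝ, 0 < c → ∀ᶠ z : ℝ in Filter.atTop, Real.log z ≤ c * z := fun c hc => by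
    filter_upwards [Real.isLittleO_log_id_atTop.def hc, Filter.eventually_ge_atTop 0] with z hz hz0
    simpa [abs_of_nonneg hz0] using (le_abs_self _).trans hz
  have hβ : 0 < Real.exp (-(10 * Real.exp 7)) / (168 * Real.exp 8) := by positivity
  filter_upwards [hk.eventually_ge_atTop 1000, hh.eventually_ge_atTop 20,
    hl.eventually (hlog 0.05 (by norm_num)), hk.eventually (hlog (1 / 6) (by norm_num)),
    hl.eventually (hlog _ hβ), hl.eventually_ge_atTop (2 / Real.exp (-7)),
    hr.eventually_ge_atTop 20, hl.eventually_gt_atTop 0] with k h1 h2 h3 h4 h5 h6 h7 h8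
  simp only [Function.comp_apply] at *
  refine ⟨h1, h2, h3, by linarith, ?_, ?_, h7⟩
  · rw [div_le_iff₀ h8]
    rw [div_mul_eq_mul_div, le_div_iff₀ (by positivity)] at h5
    linarith
  · rwa [div_le_iff₀ (Real.exp_pos _), mul_comm] at h6

lemma NearBalanced.class_bounds {n k : ℕ} {σ : Fin n → Fin k} (h : NearBalanced n k σ)
    (hk : (0 : ℝ) < k) (hr : 20 ≤ Real.log k ^ ((1 : ℝ) / 3)) (c : Fin k) :
    0.95 * n / k ≤ (Nat.card {v // σ v = c} : ℝ) ∧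
      (Nat.card {v // σ v = c} : ℝ) ≤ 2 * n / k := by
  have h1 := abs_le.mp (h c)
  have h2 : (n : ℝ) / (k * Real.log k ^ ((1 : ℝ) / 3)) ≤ 0.05 * (n / k) := by
    rw [← div_div, div_le_iff₀ (by linarith)]
    have : 0 ≤ (n : ℝ) / k := by positivity
    nlinarith
  have h3 : 0 ≤ (n : ℝ) / k := by positivity
  rw [mul_div_assoc, mul_div_assoc]
  constructor <;> linarith [h1.1, h1.2]

theorem statement14 :
    ∃ k₀ : ℕ, ∀ k : ℕ, k₀ ≤ k → ∀ d : ℝ,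
      2 * k * Real.log k - Real.log k - 4 ≤ d → d ≤ 2 * k * Real.log k →
      ∃ n₀ : ℕ, ∀ n : ℕ, n₀ ≤ n → ∀ σ : Fin n → Fin k, NearBalanced n k σ →
        prob (fun e : CondSpace n ⌈d * n / 2⌉₊ k σ =>
            -- `U = {v : ∃ j, e(v,W_j) > ℓ}`
            n * Real.log (Real.log k) / (k * Real.log k) <
              (Nat.card {v : Fin n // ∃ j : Fin k,
                  ell k < (eSet e.1 {v} (Wset σ e.1 j) : ℝ)} : ℝ))
          ≤ Real.exp (-10 * n / k) := by
  obtain ⟨k₀, hk₀⟩ := Filter.eventually_atTop.mp eventually_large_log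
  refine ⟨k₀, fun k hk d hd hd' => ?_⟩
  obtain ⟨hk1000, hh, hhl, hlk, hβ, hq2, hr⟩ := hk₀ k hk
  set l : ℝ := Real.log k with hl_def
  set h : ℝ := Real.log l with hh_def
  have hk0 : (0 : ℝ) < k := by linarith
  have hl0 : 0 < l := by linarith
  have hkl : Real.exp l = k := Real.exp_log hk0
  have hlh : Real.exp h = l := Real.exp_log hl0
  have hcast := tendsto_natCast_atTop_atTop (R := ℝ)
  obtain ⟨n₀, hn₀⟩ := Filter.eventually_atTop.mp
    ((hcast.eventually_ge_atTop 1).and ((hcast.eventually_ge_atTop (2 * (k * l) / h)).and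
      (hcast.eventually_ge_atTop (k * Real.log (2 * (1 + k))))))
  refine ⟨n₀, fun n hn σ hσ => ?_⟩
  obtain ⟨hn1, hnT, hnk⟩ := hn₀ n hn
  have hn0 : (0 : ℝ) < n := by linarith
  set T : ℝ := n * h / (k * l) with hT_def
  have hT : T * (k * l) = n * h := by rw [hT_def]; field_simp
  have hT2 : 2 ≤ T := by
    rw [hT_def, le_div_iff₀ (by positivity)]
    rwa [div_le_iff₀ (by linarith)] at hnT
  have hnkl : 1 ≤ n * k * l :=
    one_le_mul_of_one_le_of_one_le (one_le_mul_of_one_le_of_one_le hn1 (by linarith))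
      (by linarith)
  have hclass := hσ.class_bounds hk0 hr
  have hN : (n : ℝ) ^ 2 / 2 ≤ Nat.card (Bichrom σ) := by
    have := le_card_bichrom σ fun c => (hclass c).2.trans (by
      rw [Nat.card_fin, div_le_div_iff₀ hk0 (by norm_num)]
      linarith [mul_le_mul_of_nonneg_left hk1000 hn0.le])
    rwa [Nat.card_fin] at this
  have hN' : (Nat.card (Bichrom σ) : ℝ) ≤ (n : ℝ) ^ 2 := by
    have := card_bichrom_le σ
    rwa [Nat.card_fin] at this
  have hNpos : 0 < Nat.card (Bichrom σ) := by
    have : (0 : ℝ) < Nat.card (Bichrom σ) := lt_of_lt_of_le (by positivity) hN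
    exact_mod_cast this
  refine (prob_le_card_heavy σ T).trans ?_
  set m : ℕ := ⌈d * n / 2⌉₊ with hm_def
  have hq : ell k = Real.exp (-7) * l := rfl
  set u : ℕ := ⌈T / 2⌉₊ with hu_def
  set L : ℕ := ⌈ell k / 2⌉₊ with hL_def
  have hceil : ∀ z : ℝ, 0 ≤ z → z ≤ ⌈z⌉₊ ∧ (⌈z⌉₊ : ℝ) ≤ z + 1 := fun z hz =>
    ⟨Nat.le_ceil z, (Nat.ceil_lt_add_one hz).le⟩
  have hu := hceil (T / 2) (by linarith)
  have hL := hceil (ell k / 2) (by rw [hq]; linarith)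
  have hx := hceil (20 * T) (by linarith)
  have hkl1000 : 1000 * l ≤ k * l := mul_le_mul_of_nonneg_right hk1000 hl0.le
  have hdn : 0.98 * (n * k * l) ≤ d * n / 2 := by
    have h1 : l + 4 ≤ 0.04 * (k * l) := by linarith
    have h2 : 1.96 * (k * l) ≤ d := by linarith
    calc 0.98 * (n * k * l) = 1.96 * (k * l) * n / 2 := by ring
      _ ≤ _ := by gcongr
  have hdn' : d * n / 2 ≤ n * k * l := by
    calc d * n / 2 ≤ 2 * k * l * n / 2 := by gcongr
      _ = n * k * l := by ring
  have hm := hceil (d * n / 2) (by linarith)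
  rw [← hu_def] at hu
  rw [← hL_def, hq] at hL
  rw [← hm_def] at hm
  have huL : u * L ≤ m := by
    have h1 : (u : ℝ) ≤ T := by linarith
    have h2 : (L : ℝ) ≤ l / 2 := by
      linarith [mul_le_mul_of_nonneg_right exp_neg_seven_le hl0.le]
    have h3 : T ≤ n / 2 := by
      rw [hT_def, div_le_div_iff₀ (by positivity) (by norm_num), mul_assoc]
      exact mul_le_mul_of_nonneg_left (by linarith) hn0.le
    have h4 : (n : ℝ) * 1 * l ≤ n * k * l := by gcongr; linarith
    have h5 : (u : ℝ) * L ≤ m := by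
      calc (u : ℝ) * L ≤ n / 2 * (l / 2) := by gcongr; linarith
        _ ≤ m := by linarith
    exact_mod_cast h5
  have hbound := card_heavy_le_of_class_bounds (ι := Fin m) (u := u) (L := L) (x := ⌈20 * T⌉₊)
    (θ := 3 * ell k) σ
    zero_le_two (by positivity) (fun c => (hclass c).1) (fun c => (hclass c).2)
    (by rwa [Nat.card_fin]) hNpos
  simp only [Nat.card_fin, hq] at hbound
  have hnum := heavy_bound_numeric (u := u) (L := L) (x := ⌈20 * T⌉₊) (m := m) hn0 hk1000 hkl hlh hh
    hhl hlk hβ hT hu.1 (by linarith) (by linarith) (by linarith) hx.1 (by linarith) (by linarith)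
    (by linarith) hN hN'
  rw [hq, mul_div_assoc]
  calc _ ≤ 2 * ((1 + k) * Real.exp (-(16 * n / k))) := by gcongr; exact hbound.trans hnum
    _ = Real.exp (Real.log (2 * (1 + k)) + -(16 * n / k)) := by
      rw [Real.exp_add, Real.exp_log (by positivity)]; ring
    _ ≤ _ := by
      refine Real.exp_le_exp.mpr ?_
      have h1 : Real.log (2 * (1 + k)) ≤ n / k := by
        rw [le_div_iff₀ hk0]; linarith
      have h2 : 0 ≤ (n : ℝ) / k := by positivity
      rw [mul_div_assoc, mul_div_assoc]
      linarith
end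

section
/- Fix an integer k ≥ 2 and a real d > 0; for each n set m = ⌈dn/2⌉ and write d_n = 2m/n. Then for every ε > 0 there is n_0 such that for all n ≥ n_0 and every ζ: V → {0,1,...,k} with F_ζ < 1: P[𝒱] ≥ exp(−εn), where 𝒱 is the following event. Let (b_{vj})_{v∈V, j∈{0,1,...,k}} be independent Poisson random variables with means E[b_{vj}] = α_j·d_n/(1−F_ζ), let B_{ij} = Σ_{v∈V_i} b_{vj} for i,j ∈ {0,1,...,k} with (i,j) ≠ (0,0), and let B_{00} be an independent random variable such that B_{00}/2 has the Poisson distribution with mean α_0²·m/(1−F_ζ). The event 𝒱 is that (i) B_{ij} = B_{ji} for all i ≠ j, and (ii) B_{00}/2 + Σ_{0≤i<j≤k} B_{ij} = m. -/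
open MeasureTheory ProbabilityTheory

/-- The sample space of the random multigraph `G'(n,m)`. -/
abbrev MultiSpace (n m : ℕ) := Fin m → Fin n × Fin n

/-- `α_j = |ζ⁻¹(j)|/n`. -/
noncomputable def alpha {n k : ℕ} (ζ : Fin n → Fin (k + 1)) (j : Fin (k + 1)) : ℝ :=
  (Nat.card {v : Fin n // ζ v = j} : ℝ) / n

/-- `F_ζ = Σ_{j=1}^k α_j²`. -/
noncomputable def Fzeta {n k : ℕ} (ζ : Fin n → Fin (k + 1)) : ℝ :=
  ∑ j : Fin k, alpha ζ j.succ ^ 2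

/-- The number of edges (with multiplicity) joining `v` to vertices of `ζ`-color `c`. -/
noncomputable def eVC {n m k : ℕ} (ζ : Fin n → Fin (k + 1)) (e : MultiSpace n m)
    (v : Fin n) (c : Fin (k + 1)) : ℕ :=
  Nat.card {t : Fin m // ((e t).1 = v ∧ ζ (e t).2 = c) ∨ ((e t).2 = v ∧ ζ (e t).1 = c)}

/-- `I_ζ`: no edge has both endpoints in the same class `V_j` with `j ∈ {1,…,k}`. -/
def Iev {n m k : ℕ} (ζ : Fin n → Fin (k + 1)) (e : MultiSpace n m) : Prop :=
  ∀ t : Fin m, ∀ j : Fin k, ¬(ζ (e t).1 = j.succ ∧ ζ (e t).2 = j.succ)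

/-- `C_ζ`: `ζ` is a `k`-cover of the multigraph `e` (conditions CV1–CV3). -/
def Cev {n m k : ℕ} (ζ : Fin n → Fin (k + 1)) (e : MultiSpace n m) : Prop :=
  (∀ t : Fin m, ζ (e t).1 = ζ (e t).2 → ζ (e t).1 = 0) ∧
  (∀ v : Fin n, ζ v ≠ 0 → ∀ j : Fin k, j.succ ≠ ζ v → 2 ≤ eVC ζ e v j.succ) ∧
  (∀ v : Fin n, ζ v = 0 → ∃ i j : Fin k, i ≠ j ∧
    eVC ζ e v i.succ = 0 ∧ eVC ζ e v j.succ ≤ 1)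

/-- The joint distribution of the independent Poisson family `(b_{vj})` with
rates `r (v, j)`. -/
noncomputable def poissonProd (n k : ℕ) (r : Fin n × Fin (k + 1) → NNReal) :
    Measure ((Fin n × Fin (k + 1)) → ℕ) :=
  Measure.pi (fun p => (poissonPMF (r p)).toMeasure)

/-- `B_{ij} = Σ_{v ∈ V_i} b_{vj}`. -/
def Bij {n k : ℕ} (ζ : Fin n → Fin (k + 1)) (b : Fin n × Fin (k + 1) → ℕ)
    (i j : Fin (k + 1)) : ℕ :=
  ∑ v ∈ Finset.univ.filter (fun v : Fin n => ζ v = i), b (v, j)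

lemma toMeasure_poissonPMF (r : NNReal) : (poissonPMF r).toMeasure = poissonMeasure r := by
  refine Measure.ext_of_singleton fun n => ?_
  rw [PMF.toMeasure_apply_singleton _ _ (measurableSet_singleton n), poissonMeasure_singleton,
    ← poissonPMFReal_ofReal_eq_poissonPMF]
  rfl

lemma poissonMeasure_zero : poissonMeasure 0 = Measure.dirac 0 := by
  refine Measure.ext_of_singleton fun n => ?_
  rw [poissonMeasure_singleton]
  rcases n with _ | n <;> simp

lemma hasLaw_sum_pi_poissonMeasure {ι : Type*} [Fintype ι] (r : ι → NNReal) (s : Finset ι) :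
    HasLaw (fun b : ι → ℕ => ∑ i ∈ s, b i) (poissonMeasure (∑ i ∈ s, r i))
      (Measure.pi fun i => poissonMeasure (r i)) := by
  classical
  have hind : iIndepFun (fun i (b : ι → ℕ) => b i) (Measure.pi fun i => poissonMeasure (r i)) :=
    iIndepFun_pi (X := fun _ => id) fun _ => aemeasurable_id
  induction s using Finset.induction_on with
  | empty =>
    refine ⟨by fun_prop, ?_⟩
    simp [poissonMeasure_zero]
  | insert a s ha ih =>
    have h1 : HasLaw (fun b : ι → ℕ => b a) (poissonMeasure (r a))
        (Measure.pi fun i => poissonMeasure (r i)) :=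
      ⟨(measurable_pi_apply a).aemeasurable, (measurePreserving_eval _ a).map_eq⟩
    have h2 := hind.indepFun_finsetSum_of_notMem (fun i => measurable_pi_apply i) ha
    have h3 : (∑ j ∈ s, fun b : ι → ℕ => b j) = fun b : ι → ℕ => ∑ i ∈ s, b i := by
      ext b; simp
    rw [h3] at h2
    have h4 := h2.symm.hasLaw_add_poissonMeasure h1 ih
    simp only [Finset.sum_insert ha]
    exact h4

/-- Sums of independent coordinates over pairwise disjoint blocks are independent. -/
lemma pi_measure_forall_sum_eq {ι κ : Type*} [Fintype ι] (μ : ι → Measure ℕ)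
    [∀ i, IsProbabilityMeasure (μ i)] (s : κ → Finset ι) (y : κ → ℕ) (T : Finset κ)
    (hs : (T : Set κ).PairwiseDisjoint s) :
    Measure.pi μ {b | ∀ p ∈ T, ∑ i ∈ s p, b i = y p}
      = ∏ p ∈ T, Measure.pi μ {b | ∑ i ∈ s p, b i = y p} := by
  classical
  have hind : iIndepFun (fun i (b : ι → ℕ) => b i) (Measure.pi μ) :=
    iIndepFun_pi (X := fun _ => id) fun _ => aemeasurable_id
  induction T using Finset.induction_on with
  | empty => simp
  | insert a T ha ih =>
    have hd : Disjoint (s a) (T.biUnion s) := by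
      rw [Finset.disjoint_biUnion_right]
      intro p hp
      exact hs (by simp) (by simp [hp]) (by rintro rfl; exact ha hp)
    have hI := hind.indepFun_finset _ _ hd (fun i => measurable_pi_apply i)
    have hJ := hI.measure_inter_preimage_eq_mul
      {f : s a → ℕ | ∑ i, f i = y a}
      {f : T.biUnion s → ℕ | ∀ p ∈ T,
        ∑ i ∈ s p, (if h : i ∈ T.biUnion s then f ⟨i, h⟩ else 0) = y p}
      .of_discrete .of_discrete
    have e1 : (fun (b : ι → ℕ) (i : s a) => b i) ⁻¹' {f : s a → ℕ | ∑ i, f i = y a}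
        = {b | ∑ i ∈ s a, b i = y a} := by
      ext b
      simp only [Set.mem_preimage, Set.mem_ofPred_eq]
      rw [Finset.sum_coe_sort (s a) b]
    have e2 : (fun (b : ι → ℕ) (i : T.biUnion s) => b i) ⁻¹'
        {f : T.biUnion s → ℕ | ∀ p ∈ T,
          ∑ i ∈ s p, (if h : i ∈ T.biUnion s then f ⟨i, h⟩ else 0) = y p}
        = {b | ∀ p ∈ T, ∑ i ∈ s p, b i = y p} := by
      ext b
      simp only [Set.mem_preimage, Set.mem_ofPred_eq]
      refine forall₂_congr fun p hp => ?_
      rw [Finset.sum_congr rfl fun i hi => dif_pos (Finset.mem_biUnion.2 ⟨p, hp, hi⟩)]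
    rw [e1, e2] at hJ
    rw [Finset.prod_insert ha, ← ih (hs.subset (by simp)), ← hJ]
    congr 1
    ext b
    simp

lemma card_piAntidiag_le {ι : Type*} [DecidableEq ι] (s : Finset ι) (m : ℕ) :
    (s.piAntidiag m).card ≤ (m + 1) ^ s.card := by
  have h : (Fintype.piFinset fun _ : s => Finset.range (m + 1)).card = (m + 1) ^ s.card := by
    simp
  rw [← h]
  refine Finset.card_le_card_of_injOn (fun f i => f i) ?_ ?_
  · intro f hf
    rw [Finset.mem_coe, Finset.mem_piAntidiag] at hf
    rw [Finset.mem_coe, Fintype.mem_piFinset]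
    intro i
    rw [Finset.mem_range]
    have := Finset.single_le_sum (f := f) (fun j _ => Nat.zero_le _) i.2
    exact Nat.lt_succ_of_le (this.trans hf.1.le)
  · intro f hf g hg hfg
    rw [Finset.mem_coe, Finset.mem_piAntidiag] at hf hg
    ext i
    by_cases hi : i ∈ s
    · exact congrFun hfg ⟨i, hi⟩
    · have h1 : f i = 0 := by by_contra h; exact hi (hf.2 i h)
      have h2 : g i = 0 := by by_contra h; exact hi (hg.2 i h)
      rw [h1, h2]

lemma sum_piAntidiag_prod_poisson {ι : Type*} [DecidableEq ι] (s : Finset ι) (l : ι → ℝ) (m : ℕ) :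
    ∑ x ∈ s.piAntidiag m, ∏ i ∈ s, (Real.exp (-l i) * l i ^ x i / (x i).factorial)
      = Real.exp (-∑ i ∈ s, l i) * (∑ i ∈ s, l i) ^ m / m.factorial := by
  rw [Finset.sum_pow_eq_sum_piAntidiag, Finset.mul_sum, Finset.sum_div]
  refine Finset.sum_congr rfl fun x hx => ?_
  rw [Finset.mem_piAntidiag] at hx
  have h := Nat.multinomial_spec s x
  rw [hx.1] at h
  have h' : (∏ i ∈ s, ((x i).factorial : ℝ)) * (Nat.multinomial s x : ℝ) = m.factorial := by
    exact_mod_cast h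
  have hpos : (∏ i ∈ s, ((x i).factorial : ℝ)) ≠ 0 :=
    Finset.prod_ne_zero_iff.2 fun i _ => by positivity
  have hpos' : (Nat.multinomial s x : ℝ) ≠ 0 := by
    exact_mod_cast (Nat.multinomial_pos s x).ne'
  rw [Finset.prod_div_distrib, Finset.prod_mul_distrib, ← Real.exp_sum, Finset.sum_neg_distrib,
    ← h']
  field_simp

lemma exists_poisson_prod_ge {ι : Type*} [DecidableEq ι] (s : Finset ι) (l : ι → ℝ) (m : ℕ)
    (hl : 0 < ∑ i ∈ s, l i) :
    ∃ x ∈ s.piAntidiag m,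
      Real.exp (-∑ i ∈ s, l i) * (∑ i ∈ s, l i) ^ m / m.factorial ≤
        (m + 1 : ℝ) ^ s.card *
          ∏ i ∈ s, (Real.exp (-l i) * l i ^ x i / (x i).factorial) := by
  by_contra! hcon
  have hS : 0 < Real.exp (-∑ i ∈ s, l i) * (∑ i ∈ s, l i) ^ m / m.factorial := by
    positivity
  have hsum := sum_piAntidiag_prod_poisson s l m
  set S := Real.exp (-∑ i ∈ s, l i) * (∑ i ∈ s, l i) ^ m / m.factorial with hSdef
  have hne : (s.piAntidiag m).Nonempty := by
    by_contra h
    rw [Finset.not_nonempty_iff_eq_empty] at h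
    rw [h, Finset.sum_empty] at hsum
    exact hS.ne hsum
  have h1 := Finset.sum_lt_sum_of_nonempty hne hcon
  rw [← Finset.mul_sum, hsum, Finset.sum_const, nsmul_eq_mul] at h1
  have h2 : ((s.piAntidiag m).card : ℝ) ≤ (m + 1 : ℝ) ^ s.card := by
    exact_mod_cast card_piAntidiag_le s m
  exact absurd (mul_le_mul_of_nonneg_right h2 hS.le) (not_le.2 h1)

lemma factorial_mul_exp_le {m : ℕ} (hm : 1 ≤ m) :
    (m.factorial : ℝ) * Real.exp m ≤ Real.exp 1 * m ^ (m + 1) := by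
  induction m, hm using Nat.le_induction with
  | base => simp
  | succ m hm ih =>
    have hm0 : (0 : ℝ) < m := by exact_mod_cast hm
    have key : Real.exp 1 * (m : ℝ) ^ (m + 1) ≤ ((m : ℝ) + 1) ^ (m + 1) := by
      have h1 : 1 - (((m : ℝ) + 1) / m)⁻¹ ≤ Real.log (((m : ℝ) + 1) / m) :=
        Real.one_sub_inv_le_log_of_pos (by positivity)
      have h2 : (1 : ℝ) ≤ ((m + 1 : ℕ) : ℝ) * Real.log (((m : ℝ) + 1) / m) := by
        have : (1 : ℝ) = ((m + 1 : ℕ) : ℝ) * (1 - (((m : ℝ) + 1) / m)⁻¹) := by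
          push_cast; field_simp; ring
        exact this.le.trans (mul_le_mul_of_nonneg_left h1 (Nat.cast_nonneg _))
      have h3 := Real.exp_le_exp.2 h2
      rw [Real.exp_nat_mul, Real.exp_log (by positivity), div_pow, le_div_iff₀ (by positivity)] at h3
      exact h3
    rw [Nat.factorial_succ]
    push_cast
    rw [Real.exp_add]
    calc ((m : ℝ) + 1) * m.factorial * (Real.exp m * Real.exp 1)
        = ((m : ℝ) + 1) * Real.exp 1 * (m.factorial * Real.exp m) := by ring
      _ ≤ ((m : ℝ) + 1) * Real.exp 1 * (Real.exp 1 * m ^ (m + 1)) := by gcongr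
      _ ≤ ((m : ℝ) + 1) * Real.exp 1 * ((m : ℝ) + 1) ^ (m + 1) := by gcongr
      _ = Real.exp 1 * ((m : ℝ) + 1) ^ (m + 1 + 1) := by ring

lemma one_le_mul_poisson_mode {m : ℕ} (hm : 1 ≤ m) :
    1 ≤ Real.exp 1 * m * (Real.exp (-(m : ℝ)) * (m : ℝ) ^ m / m.factorial) := by
  have h := factorial_mul_exp_le hm
  have h0 : (0 : ℝ) < m.factorial := by positivity
  rw [Real.exp_neg, ← mul_div_assoc, le_div_iff₀ h0, one_mul]
  rw [← le_div_iff₀ (Real.exp_pos _)] at h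
  calc (m.factorial : ℝ) ≤ _ := h
    _ = _ := by ring

@[to_additive]
lemma prod_offDiag_eq_prod_lt_pow_two {ι M : Type*} [Fintype ι] [LinearOrder ι] [CommMonoid M]
    (f : ι × ι → M) (hf : ∀ p, f p.swap = f p) :
    ∏ p : ι × ι with p.1 ≠ p.2, f p = (∏ p : ι × ι with p.1 < p.2, f p) ^ 2 := by
  have h1 : (Finset.univ.filter fun p : ι × ι => p.1 ≠ p.2)
      = (Finset.univ.filter fun p : ι × ι => p.1 < p.2)
        ∪ (Finset.univ.filter fun p : ι × ι => p.2 < p.1) := by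
    ext p; simp
  have h2 : Disjoint (Finset.univ.filter fun p : ι × ι => p.1 < p.2)
      (Finset.univ.filter fun p : ι × ι => p.2 < p.1) := by
    rw [Finset.disjoint_filter]
    intro p _ h h'
    exact lt_asymm h h'
  have h3 : ∏ p : ι × ι with p.2 < p.1, f p = ∏ p : ι × ι with p.1 < p.2, f p :=
    Finset.prod_nbij' Prod.swap Prod.swap (by simp) (by simp) (by simp) (by simp)
      (fun p _ => (hf p).symm)
  rw [h1, Finset.prod_union h2, h3, sq]

lemma eventually_const_mul_pow_le_exp (C ε : ℝ) (hε : 0 < ε) (L : ℕ) :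
    ∀ᶠ n : ℕ in Filter.atTop, C * (n : ℝ) ^ L ≤ Real.exp (ε * n) := by
  have h := ((isLittleO_pow_exp_pos_mul_atTop L hε).const_mul_left C).comp_tendsto
    tendsto_natCast_atTop_atTop
  filter_upwards [h.bound one_pos] with n hn
  simp only [Function.comp_apply, Real.norm_eq_abs, one_mul, Real.abs_exp] at hn
  exact (le_abs_self _).trans hn

lemma alpha_nonneg {n k : ℕ} (ζ : Fin n → Fin (k + 1)) (j : Fin (k + 1)) : 0 ≤ alpha ζ j := by
  unfold alpha; positivity

lemma card_fiber_eq_mul_alpha {n k : ℕ} (hn : 0 < n) (ζ : Fin n → Fin (k + 1))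
    (j : Fin (k + 1)) :
    ((Finset.univ.filter fun v => ζ v = j).card : ℝ) = n * alpha ζ j := by
  have : (n : ℝ) ≠ 0 := by positivity
  rw [alpha, Nat.card_eq_fintype_card, Fintype.card_subtype, mul_div_cancel₀ _ this]

lemma sum_alpha {n k : ℕ} (hn : 0 < n) (ζ : Fin n → Fin (k + 1)) : ∑ j, alpha ζ j = 1 := by
  have hn' : (n : ℝ) ≠ 0 := by positivity
  have h : ((Finset.univ : Finset (Fin n)).card : ℝ) = ∑ j, (n * alpha ζ j) := by
    rw [Finset.card_eq_sum_card_fiberwise (f := ζ) (t := Finset.univ) (by simp), Nat.cast_sum]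
    exact Finset.sum_congr rfl fun j _ => card_fiber_eq_mul_alpha hn ζ j
  rw [← Finset.mul_sum, Finset.card_univ, Fintype.card_fin] at h
  exact (mul_left_cancel₀ hn' (by rw [mul_one]; exact h)).symm

lemma sq_alpha_zero_add_two_mul_sum {n k : ℕ} (hn : 0 < n) (ζ : Fin n → Fin (k + 1)) :
    alpha ζ 0 ^ 2 + 2 * ∑ p : Fin (k + 1) × Fin (k + 1) with p.1 < p.2,
      alpha ζ p.1 * alpha ζ p.2 = 1 - Fzeta ζ := by
  have h1 := sum_offDiag_eq_sum_lt_nsmul_two (fun p : Fin (k + 1) × Fin (k + 1) =>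
    alpha ζ p.1 * alpha ζ p.2) fun p => mul_comm _ _
  have h2 : ∑ p : Fin (k + 1) × Fin (k + 1) with p.1 = p.2, alpha ζ p.1 * alpha ζ p.2
      = ∑ j, alpha ζ j ^ 2 := by
    symm
    refine Finset.sum_nbij' (fun j => (j, j)) Prod.fst (by simp) (by simp) (by simp) ?_ ?_
    · rintro ⟨a, b⟩ hab
      simp only [Finset.mem_filter, Finset.mem_univ, true_and] at hab
      simp [hab]
    · intro j _
      exact sq _
  have h3 : ∑ p : Fin (k + 1) × Fin (k + 1), alpha ζ p.1 * alpha ζ p.2 = 1 := by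
    rw [Fintype.sum_prod_type]
    simp_rw [← Finset.mul_sum]
    rw [← Finset.sum_mul, sum_alpha hn, mul_one]
  rw [← Finset.sum_filter_add_sum_filter_not _ (fun p => p.1 = p.2), h2, h1,
    Fin.sum_univ_succ, nsmul_eq_mul] at h3
  unfold Fzeta
  push_cast at h3
  linarith

/-- The pairs of colours `i < j`, together with the pair `(0, 0)`. -/
def edgeTypes (k : ℕ) : Finset (Fin (k + 1) × Fin (k + 1)) :=
  insert (0, 0) (Finset.univ.filter fun p => p.1 < p.2)

/-- The mean of `B_{ij}` for `i ≠ j`, and of `B_{00} / 2` for `(i, j) = (0, 0)`. -/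
noncomputable def edgeMean {n k : ℕ} (ζ : Fin n → Fin (k + 1)) (m : ℕ)
    (p : Fin (k + 1) × Fin (k + 1)) : ℝ :=
  (if p = (0, 0) then 1 else 2) * (alpha ζ p.1 * alpha ζ p.2) * m / (1 - Fzeta ζ)

lemma edgeMean_nonneg {n k : ℕ} (ζ : Fin n → Fin (k + 1)) (hF : Fzeta ζ < 1) (m : ℕ)
    (p : Fin (k + 1) × Fin (k + 1)) : 0 ≤ edgeMean ζ m p := by
  have h1 := alpha_nonneg ζ p.1
  have h2 := alpha_nonneg ζ p.2
  have h3 : 0 < 1 - Fzeta ζ := sub_pos.2 hF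
  unfold edgeMean
  split_ifs <;> positivity

lemma edgeMean_zero_zero {n k : ℕ} (ζ : Fin n → Fin (k + 1)) (m : ℕ) :
    edgeMean ζ m (0, 0) = alpha ζ 0 ^ 2 * m / (1 - Fzeta ζ) := by
  simp [edgeMean, sq]

lemma edgeMean_of_ne {n k : ℕ} (ζ : Fin n → Fin (k + 1)) (m : ℕ)
    {p : Fin (k + 1) × Fin (k + 1)} (hp : p.1 ≠ p.2) :
    edgeMean ζ m p = 2 * (alpha ζ p.1 * alpha ζ p.2) * m / (1 - Fzeta ζ) := by
  rw [edgeMean, if_neg]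
  rintro rfl
  exact hp rfl

lemma sum_edgeTypes {k : ℕ} {M : Type*} [AddCommMonoid M]
    (f : Fin (k + 1) × Fin (k + 1) → M) :
    ∑ p ∈ edgeTypes k, f p
      = f (0, 0) + ∑ p : Fin (k + 1) × Fin (k + 1) with p.1 < p.2, f p :=
  Finset.sum_insert (by simp)

lemma prod_edgeTypes {k : ℕ} {M : Type*} [CommMonoid M]
    (f : Fin (k + 1) × Fin (k + 1) → M) :
    ∏ p ∈ edgeTypes k, f p
      = f (0, 0) * ∏ p : Fin (k + 1) × Fin (k + 1) with p.1 < p.2, f p :=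
  Finset.prod_insert (by simp)

lemma sum_edgeMean {n k : ℕ} (hn : 0 < n) (ζ : Fin n → Fin (k + 1)) (hF : Fzeta ζ < 1) (m : ℕ) :
    ∑ p ∈ edgeTypes k, edgeMean ζ m p = m := by
  have h3 : 1 - Fzeta ζ ≠ 0 := (sub_pos.2 hF).ne'
  rw [sum_edgeTypes, edgeMean_zero_zero, Finset.sum_congr rfl fun p hp =>
    edgeMean_of_ne ζ m (Finset.mem_filter.1 hp).2.ne, ← Finset.sum_div, ← Finset.sum_mul,
    ← Finset.mul_sum, ← add_div, ← add_mul, sq_alpha_zero_add_two_mul_sum hn,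
    mul_div_cancel_left₀ _ h3]

lemma Bij_eq_sum {n k : ℕ} (ζ : Fin n → Fin (k + 1)) (b : Fin n × Fin (k + 1) → ℕ)
    (p : Fin (k + 1) × Fin (k + 1)) :
    Bij ζ b p.1 p.2 = ∑ q ∈ (Finset.univ.filter fun v => ζ v = p.1) ×ˢ {p.2}, b q := by
  rw [Finset.sum_product]
  simp [Bij]

lemma poissonProd_Bij_eq {n k : ℕ} (hn : 0 < n) (ζ : Fin n → Fin (k + 1)) (hF : Fzeta ζ < 1)
    (m : ℕ) {y : Fin (k + 1) × Fin (k + 1) → ℕ} :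
    poissonProd n k (fun p =>
      Real.toNNReal (alpha ζ p.2 * (2 * (m : ℝ) / n) / (1 - Fzeta ζ)))
      {b | ∀ p ∈ Finset.univ.filter fun p : Fin (k + 1) × Fin (k + 1) => p.1 ≠ p.2,
        Bij ζ b p.1 p.2 = y p}
      = ∏ p : Fin (k + 1) × Fin (k + 1) with p.1 ≠ p.2, ENNReal.ofReal
        (Real.exp (-edgeMean ζ m p) * edgeMean ζ m p ^ y p / (y p).factorial) := by
  have hF' : 0 < 1 - Fzeta ζ := sub_pos.2 hF
  have hn' : (n : ℝ) ≠ 0 := by positivity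
  simp_rw [poissonProd, toMeasure_poissonPMF, Bij_eq_sum]
  rw [pi_measure_forall_sum_eq]
  · refine Finset.prod_congr rfl fun p hp => ?_
    set r : Fin n × Fin (k + 1) → NNReal := fun p =>
      Real.toNNReal (alpha ζ p.2 * (2 * (m : ℝ) / n) / (1 - Fzeta ζ)) with hr
    have hlaw := hasLaw_sum_pi_poissonMeasure r
      ((Finset.univ.filter fun v => ζ v = p.1) ×ˢ {p.2})
    rw [hlaw.measure_eq (p := fun x => x = y p) .of_discrete]
    have hsum : ((∑ q ∈ (Finset.univ.filter fun v => ζ v = p.1) ×ˢ {p.2}, r q : NNReal) : ℝ)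
        = edgeMean ζ m p := by
      have ha := alpha_nonneg ζ p.2
      rw [Finset.sum_product, edgeMean_of_ne ζ m (Finset.mem_filter.1 hp).2]
      simp only [Finset.sum_singleton, Finset.sum_const, nsmul_eq_mul, hr]
      push_cast
      rw [Real.coe_toNNReal _ (by positivity), card_fiber_eq_mul_alpha hn]
      field_simp
    rw [show {x | x = y p} = {y p} from rfl, poissonMeasure_singleton, hsum]
  · intro p _ q _ hpq
    rw [Function.onFun, Finset.disjoint_left]
    rintro ⟨v, j⟩ h1 h2
    simp only [Finset.mem_product, Finset.mem_filter, Finset.mem_univ, true_and,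
      Finset.mem_singleton] at h1 h2
    exact hpq (Prod.ext (h1.1.symm.trans h2.1) (h1.2.symm.trans h2.2))

lemma exp_neg_mul_pow_div_factorial_le_one {r : ℝ} (hr : 0 ≤ r) (x : ℕ) :
    Real.exp (-r) * r ^ x / x.factorial ≤ 1 := by
  rw [mul_div_assoc, Real.exp_neg, inv_mul_le_iff₀ (Real.exp_pos r), mul_one]
  exact Real.pow_div_factorial_le_exp r hr x

lemma sq_inv_le_measure_balanced {n k : ℕ} (hn : 0 < n) (ζ : Fin n → Fin (k + 1))
    (hF : Fzeta ζ < 1) {m : ℕ} (hm : 1 ≤ m) :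
    ((Real.exp 1 * m * (m + 1) ^ (edgeTypes k).card)⁻¹) ^ 2 ≤
      (((poissonProd n k (fun p =>
            Real.toNNReal (alpha ζ p.2 * (2 * (m : ℝ) / n) / (1 - Fzeta ζ)))).prod
          ((poissonPMF (Real.toNNReal
            (alpha ζ 0 ^ 2 * (m : ℝ) / (1 - Fzeta ζ)))).toMeasure)
          {bc : (Fin n × Fin (k + 1) → ℕ) × ℕ |
            (∀ i j : Fin (k + 1), i ≠ j → Bij ζ bc.1 i j = Bij ζ bc.1 j i) ∧
            bc.2 + (∑ p ∈ Finset.univ.filter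
                (fun p : Fin (k + 1) × Fin (k + 1) => p.1 < p.2),
              Bij ζ bc.1 p.1 p.2) = m})).toReal := by
  have hm0 : (0 : ℝ) < m := by exact_mod_cast hm
  have hsum := sum_edgeMean hn ζ hF m
  obtain ⟨x, hx, hge⟩ := exists_poisson_prod_ge (edgeTypes k) (edgeMean ζ m) m (by rwa [hsum])
  rw [Finset.mem_piAntidiag] at hx
  rw [hsum] at hge
  set w : Fin (k + 1) × Fin (k + 1) → ℝ := fun p =>
    Real.exp (-edgeMean ζ m p) * edgeMean ζ m p ^ x p / (x p).factorial with hw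
  have hw0 : ∀ p, 0 ≤ w p := fun p => by
    have := edgeMean_nonneg ζ hF m p
    simp only [hw]; positivity
  set y : Fin (k + 1) × Fin (k + 1) → ℕ := fun p => if p.1 < p.2 then x p else x p.swap with hy
  set u : Fin (k + 1) × Fin (k + 1) → ℝ := fun p =>
    Real.exp (-edgeMean ζ m p) * edgeMean ζ m p ^ y p / (y p).factorial with hu
  have hu0 : ∀ p, 0 ≤ u p := fun p => by
    have := edgeMean_nonneg ζ hF m p
    simp only [hu]; positivity
  have hyswap : ∀ p : Fin (k + 1) × Fin (k + 1), p.1 ≠ p.2 → y p.swap = y p := by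
    rintro ⟨i, j⟩ hij
    simp only [hy, Prod.fst_swap, Prod.snd_swap, Prod.swap_swap]
    rcases lt_or_gt_of_ne hij with h | h
    · simp only at h; rw [if_neg h.not_gt, if_pos h]
    · simp only at h; rw [if_pos h, if_neg h.not_gt]
  have huswap : ∀ p : Fin (k + 1) × Fin (k + 1), u p.swap = u p := by
    intro p
    by_cases hp : p.1 = p.2
    · rw [show p.swap = p from Prod.ext hp.symm hp]
    · have hp' : p.swap.1 ≠ p.swap.2 := fun h => hp h.symm
      simp only [hu, hyswap p hp, edgeMean_of_ne ζ m hp, edgeMean_of_ne ζ m hp', Prod.fst_swap,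
        Prod.snd_swap, mul_comm (alpha ζ p.2)]
  have huw : ∏ p : Fin (k + 1) × Fin (k + 1) with p.1 < p.2, u p
      = ∏ p : Fin (k + 1) × Fin (k + 1) with p.1 < p.2, w p := by
    refine Finset.prod_congr rfl fun p hp => ?_
    simp only [hu, hw, hy, if_pos (Finset.mem_filter.1 hp).2]
  have hprod : ((∏ p ∈ edgeTypes k, w p)) ^ 2
      ≤ (∏ p : Fin (k + 1) × Fin (k + 1) with p.1 ≠ p.2, u p) * w (0, 0) := by
    rw [prod_edgeTypes, prod_offDiag_eq_prod_lt_pow_two u huswap, huw, mul_pow, mul_comm]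
    have h1 : w (0, 0) ≤ 1 :=
      exp_neg_mul_pow_div_factorial_le_one (edgeMean_nonneg ζ hF m _) _
    have h2 := hw0 (0, 0)
    exact mul_le_mul_of_nonneg_left (by nlinarith) (sq_nonneg _)
  have hlow : (Real.exp 1 * m * (m + 1) ^ (edgeTypes k).card)⁻¹ ≤ ∏ p ∈ edgeTypes k, w p := by
    rw [inv_le_iff_one_le_mul₀ (by positivity), mul_comm]
    refine (one_le_mul_poisson_mode hm).trans ?_
    rw [mul_assoc (Real.exp 1 * (m : ℝ))]
    exact mul_le_mul_of_nonneg_left hge (by positivity)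
  refine (pow_le_pow_left₀ (by positivity) hlow 2).trans (hprod.trans ?_)
  have hsub : {b | ∀ p ∈ Finset.univ.filter fun p : Fin (k + 1) × Fin (k + 1) => p.1 ≠ p.2,
        Bij ζ b p.1 p.2 = y p} ×ˢ {x (0, 0)} ⊆
      {bc : (Fin n × Fin (k + 1) → ℕ) × ℕ |
            (∀ i j : Fin (k + 1), i ≠ j → Bij ζ bc.1 i j = Bij ζ bc.1 j i) ∧
            bc.2 + (∑ p ∈ Finset.univ.filter
                (fun p : Fin (k + 1) × Fin (k + 1) => p.1 < p.2),
              Bij ζ bc.1 p.1 p.2) = m} := by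
    rintro ⟨b, c⟩ ⟨hb, hc⟩
    have hb' : ∀ p : Fin (k + 1) × Fin (k + 1), p.1 ≠ p.2 → Bij ζ b p.1 p.2 = y p :=
      fun p hp => hb p (by simpa using hp)
    have hc' : c = x (0, 0) := hc
    refine ⟨fun i j hij => ?_, ?_⟩
    · exact (hb' (i, j) hij).trans ((hyswap (i, j) hij).symm.trans (hb' (j, i) hij.symm).symm)
    · rw [← hx.1, sum_edgeTypes, hc']
      congr 1
      refine Finset.sum_congr rfl fun p hp => ?_
      have hlt := (Finset.mem_filter.1 hp).2
      simp only [hb' p hlt.ne, hy, if_pos hlt]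
  have : IsProbabilityMeasure (poissonProd n k (fun p =>
      Real.toNNReal (alpha ζ p.2 * (2 * (m : ℝ) / n) / (1 - Fzeta ζ)))) := by
    unfold poissonProd; infer_instance
  refine le_trans (le_of_eq ?_) (ENNReal.toReal_mono (measure_ne_top _ _) (measure_mono hsub))
  rw [Measure.prod_prod, poissonProd_Bij_eq hn ζ hF, toMeasure_poissonPMF,
    poissonMeasure_singleton, ENNReal.toReal_mul, ENNReal.toReal_prod, ← edgeMean_zero_zero,
    Real.coe_toNNReal _ (edgeMean_nonneg ζ hF m _), ENNReal.toReal_ofReal (hw0 (0, 0))]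
  congr 1
  exact Finset.prod_congr rfl fun p _ => (ENNReal.toReal_ofReal (hu0 p)).symm

theorem statement19 (k : ℕ) (hk : 2 ≤ k) (d : ℝ) (hd : 0 < d) (ε : ℝ) (hε : 0 < ε) :
    ∃ n₀ : ℕ, ∀ n : ℕ, n₀ ≤ n → ∀ ζ : Fin n → Fin (k + 1), Fzeta ζ < 1 →
      -- the law of `((b_{vj})_{v,j}, B_{00}/2)`: independent Poissons with the given
      -- rates (`d_n = 2m/n`), with the extra coordinate `B_{00}/2 ~ Po(α₀²·m/(1−F_ζ))`
      Real.exp (-(ε * n)) ≤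
        (((poissonProd n k (fun p =>
            Real.toNNReal (alpha ζ p.2 * (2 * (⌈d * n / 2⌉₊ : ℝ) / n) / (1 - Fzeta ζ)))).prod
          ((poissonPMF (Real.toNNReal
            (alpha ζ 0 ^ 2 * (⌈d * n / 2⌉₊ : ℝ) / (1 - Fzeta ζ)))).toMeasure)
          {bc : (Fin n × Fin (k + 1) → ℕ) × ℕ |
            (∀ i j : Fin (k + 1), i ≠ j → Bij ζ bc.1 i j = Bij ζ bc.1 j i) ∧
            bc.2 + (∑ p ∈ Finset.univ.filter
                (fun p : Fin (k + 1) × Fin (k + 1) => p.1 < p.2),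
              Bij ζ bc.1 p.1 p.2) = ⌈d * n / 2⌉₊})).toReal := by
  set L := (edgeTypes k).card
  obtain ⟨N, hN⟩ := Filter.eventually_atTop.1 (eventually_const_mul_pow_le_exp
    ((Real.exp 1 * (d / 2 + 2) ^ (L + 1)) ^ 2) ε hε ((L + 1) * 2))
  refine ⟨max N 1, fun n hn ζ hF => ?_⟩
  have hn1 : 1 ≤ n := (le_max_right _ _).trans hn
  have hnR : (1 : ℝ) ≤ n := by exact_mod_cast hn1
  have hm : 1 ≤ ⌈d * n / 2⌉₊ := Nat.one_le_ceil_iff.2 (by positivity)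
  have hmle : (⌈d * n / 2⌉₊ : ℝ) + 1 ≤ (d / 2 + 2) * n := by
    have := Nat.ceil_lt_add_one (show 0 ≤ d * n / 2 by positivity)
    nlinarith
  refine le_trans ?_ (sq_inv_le_measure_balanced hn1 ζ hF hm)
  generalize ⌈d * n / 2⌉₊ = m at hm hmle
  have hm0 : (0 : ℝ) < m := by exact_mod_cast hm
  rw [Real.exp_neg, inv_pow]
  refine inv_anti₀ (by positivity) (le_trans ?_ (hN n ((le_max_left _ _).trans hn)))
  rw [pow_mul, ← mul_pow]
  refine pow_le_pow_left₀ (by positivity) ?_ 2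
  calc Real.exp 1 * m * ((m : ℝ) + 1) ^ L
      ≤ Real.exp 1 * ((m : ℝ) + 1) * ((m : ℝ) + 1) ^ L := by gcongr; linarith
    _ = Real.exp 1 * ((m : ℝ) + 1) ^ (L + 1) := by ring
    _ ≤ Real.exp 1 * ((d / 2 + 2) * n) ^ (L + 1) := by gcongr
    _ = Real.exp 1 * (d / 2 + 2) ^ (L + 1) * (n : ℝ) ^ (L + 1) := by rw [mul_pow]; ring
end
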